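/- There exist absolute constants C₀, C_d, C_T > 0 such that, in the setting of a μ-incoherent rank-r matrix M ∈ ℝ^{m×n} (m ≥ n), δ = Σmin/(C_d·r^{3/2}·κ), and Ω drawn uniformly at random among all subsets of [m]×[n] of cardinality S with S ≥ C₀·α·n·r·κ²·max{μ·log n, √α·μ²·r⁶·κ⁴}, the following holds with probability at least 1 − 2/n⁴: for every sequence ((X_k, Y_k))_{k∈ℕ} with (X_k, Y_k) ∈ K₁ ∩ K₂ ∩ K(δ) for all k, every limit point (X*, Y*) of this sequence that satisfies ∇_X F̃(X*,Y*) = 0 and ∇_Y F̃(X*,Y*) = 0 also satisfies X*·(Y*)ᵀ = M. -/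

import Mathlib

open Matrix
open scoped Classical

noncomputable section

/-- Frobenius norm of a real matrix. -/
def frob {m n : ℕ} (A : Matrix (Fin m) (Fin n) ℝ) : ℝ :=
  Real.sqrt (∑ i, ∑ j, A i j ^ 2)

/-- Euclidean norm of the `i`-th row of a matrix. -/
def rowNorm {m n : ℕ} (A : Matrix (Fin m) (Fin n) ℝ) (i : Fin m) : ℝ :=
  Real.sqrt (∑ j, A i j ^ 2)

/-- Frobenius inner product `⟨A,B⟩ = trace(AᵀB)`. -/
def finner {m n : ℕ} (A B : Matrix (Fin m) (Fin n) ℝ) : ℝ :=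
  ∑ i, ∑ j, A i j * B i j

/-- Projection onto the set of entries indexed by `Ω` (other entries are set to `0`). -/
def projOmega {m n : ℕ} (Ω : Finset (Fin m × Fin n)) (A : Matrix (Fin m) (Fin n) ℝ) :
    Matrix (Fin m) (Fin n) ℝ :=
  Matrix.of fun i j => if (i, j) ∈ Ω then A i j else 0

/-- `G₀(z) = (max{0, z-1})²`. -/
def G0 (z : ℝ) : ℝ := max 0 (z - 1) ^ 2

/-- `G₀′(z) = 2·max{0, z-1}`. -/
def G0' (z : ℝ) : ℝ := 2 * max 0 (z - 1)

/-- The matrix whose `i`-th row is the `i`-th row of `A` and whose other rows vanish. -/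
def rowMat {m n : ℕ} (A : Matrix (Fin m) (Fin n) ℝ) (i : Fin m) :
    Matrix (Fin m) (Fin n) ℝ :=
  Matrix.of fun i' j => if i' = i then A i j else 0

/-- The regularizer `G(X,Y)`. -/
def Greg {m n r : ℕ} (ρ β1 β2 βT : ℝ) (X : Matrix (Fin m) (Fin r) ℝ)
    (Y : Matrix (Fin n) (Fin r) ℝ) : ℝ :=
  ρ * ∑ i, G0 (3 * rowNorm X i ^ 2 / (2 * β1 ^ 2)) +
    ρ * ∑ j, G0 (3 * rowNorm Y j ^ 2 / (2 * β2 ^ 2)) +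
    ρ * G0 (3 * frob X ^ 2 / (2 * βT ^ 2)) +
    ρ * G0 (3 * frob Y ^ 2 / (2 * βT ^ 2))

/-- The regularized objective `F̃(X,Y)`. -/
def Ftilde {m n r : ℕ} (Ω : Finset (Fin m × Fin n)) (M : Matrix (Fin m) (Fin n) ℝ)
    (ρ β1 β2 βT : ℝ) (X : Matrix (Fin m) (Fin r) ℝ) (Y : Matrix (Fin n) (Fin r) ℝ) : ℝ :=
  (1 / 2) * frob (projOmega Ω (M - X * Yᵀ)) ^ 2 + Greg ρ β1 β2 βT X Y

/-- Gradient of the regularizer with respect to one of the factors. -/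
def gradG1 {m r : ℕ} (ρ β βT : ℝ) (X : Matrix (Fin m) (Fin r) ℝ) :
    Matrix (Fin m) (Fin r) ℝ :=
  (∑ i, (ρ * G0' (3 * rowNorm X i ^ 2 / (2 * β ^ 2)) * (3 / β ^ 2)) • rowMat X i) +
    (ρ * G0' (3 * frob X ^ 2 / (2 * βT ^ 2)) * (3 / βT ^ 2)) • X

/-- `∇_X F̃(X,Y)`. -/
def gradX {m n r : ℕ} (Ω : Finset (Fin m × Fin n)) (M : Matrix (Fin m) (Fin n) ℝ)
    (ρ β1 βT : ℝ) (X : Matrix (Fin m) (Fin r) ℝ) (Y : Matrix (Fin n) (Fin r) ℝ) :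
    Matrix (Fin m) (Fin r) ℝ :=
  projOmega Ω (X * Yᵀ - M) * Y + gradG1 ρ β1 βT X

/-- `∇_Y F̃(X,Y)`. -/
def gradY {m n r : ℕ} (Ω : Finset (Fin m × Fin n)) (M : Matrix (Fin m) (Fin n) ℝ)
    (ρ β2 βT : ℝ) (X : Matrix (Fin m) (Fin r) ℝ) (Y : Matrix (Fin n) (Fin r) ℝ) :
    Matrix (Fin n) (Fin r) ℝ :=
  (projOmega Ω (X * Yᵀ - M))ᵀ * X + gradG1 ρ β2 βT Y

/-- Membership in `K₁`. -/
def K1mem {m n r : ℕ} (β1 β2 : ℝ) (X : Matrix (Fin m) (Fin r) ℝ)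
    (Y : Matrix (Fin n) (Fin r) ℝ) : Prop :=
  (∀ i, rowNorm X i ≤ β1) ∧ ∀ j, rowNorm Y j ≤ β2

/-- Membership in `K₂`. -/
def K2mem {m n r : ℕ} (βT : ℝ) (X : Matrix (Fin m) (Fin r) ℝ)
    (Y : Matrix (Fin n) (Fin r) ℝ) : Prop :=
  frob X ≤ βT ∧ frob Y ≤ βT

/-- Membership in `K(t) = {(X,Y) : ‖M - XYᵀ‖_F ≤ t}`. -/
def Kmem {m n r : ℕ} (M : Matrix (Fin m) (Fin n) ℝ) (t : ℝ)
    (X : Matrix (Fin m) (Fin r) ℝ) (Y : Matrix (Fin n) (Fin r) ℝ) : Prop :=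
  frob (M - X * Yᵀ) ≤ t

lemma mc_spec {ι : Type*} [Fintype ι] [DecidableEq ι] (H : Matrix ι ι ℝ) (hH : H.IsHermitian) :
    ∃ (O : Matrix ι ι ℝ) (l : ι → ℝ), Oᵀ * O = 1 ∧ O * Oᵀ = 1 ∧
      ∀ k : ℕ, H ^ k = O * diagonal (fun i => l i ^ k) * Oᵀ := by
  have h := hH.spectral_theorem
  set U := hH.eigenvectorUnitary
  have hU1 : (U : Matrix ι ι ℝ)ᵀ * (U : Matrix ι ι ℝ) = 1 := by
    have := Unitary.coe_star_mul_self U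
    simpa [star_eq_conjTranspose, conjTranspose_eq_transpose_of_trivial] using this
  have hU2 : (U : Matrix ι ι ℝ) * (U : Matrix ι ι ℝ)ᵀ = 1 := by
    have := Unitary.coe_mul_star_self U
    simpa [star_eq_conjTranspose, conjTranspose_eq_transpose_of_trivial] using this
  refine ⟨U, hH.eigenvalues, hU1, hU2, ?_⟩
  have h1 : H = (U : Matrix ι ι ℝ) * diagonal hH.eigenvalues * (U : Matrix ι ι ℝ)ᵀ := by
    rw [Unitary.conjStarAlgAut_apply] at h
    simpa [star_eq_conjTranspose, conjTranspose_eq_transpose_of_trivial, Function.comp_def] using h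
  intro k
  induction k with
  | zero => simp [hU2]
  | succ k ih =>
    rw [pow_succ, ih]
    calc _ = (U : Matrix ι ι ℝ) * diagonal (fun i => hH.eigenvalues i ^ k) * (U : Matrix ι ι ℝ)ᵀ * ((U : Matrix ι ι ℝ) * diagonal hH.eigenvalues * (U : Matrix ι ι ℝ)ᵀ) := by rw [← h1]
      _ = (U : Matrix ι ι ℝ) * diagonal (fun i => hH.eigenvalues i ^ k) * ((U : Matrix ι ι ℝ)ᵀ * (U : Matrix ι ι ℝ)) * diagonal hH.eigenvalues * (U : Matrix ι ι ℝ)ᵀ := by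
          simp only [Matrix.mul_assoc]
      _ = _ := by
          rw [hU1, Matrix.mul_one, Matrix.mul_assoc _ (diagonal _) (diagonal _), diagonal_mul_diagonal]
          simp [pow_succ]

lemma mc_quad {ι : Type*} [Fintype ι] [DecidableEq ι] (O : Matrix ι ι ℝ) (d w : ι → ℝ) :
    w ⬝ᵥ ((O * diagonal d * Oᵀ) *ᵥ w) = ∑ i, d i * (Oᵀ *ᵥ w) i ^ 2 := by
  rw [← Matrix.mulVec_mulVec, ← Matrix.mulVec_mulVec, Matrix.dotProduct_mulVec, ← Matrix.mulVec_transpose]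
  simp [dotProduct, Matrix.mulVec_diagonal]
  refine Finset.sum_congr rfl fun i _ => by ring

lemma mc_tr {ι : Type*} [Fintype ι] [DecidableEq ι] (O : Matrix ι ι ℝ) (hO : Oᵀ * O = 1) (d : ι → ℝ) :
    (O * diagonal d * Oᵀ).trace = ∑ i, d i := by
  rw [Matrix.trace_mul_comm, ← Matrix.mul_assoc, hO, Matrix.one_mul, Matrix.trace_diagonal]

/-- all the spectral info at once -/
lemma mc_spec2 {ι : Type*} [Fintype ι] [DecidableEq ι] (H : Matrix ι ι ℝ) (hH : H.IsHermitian)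
    (h1 : ∀ w, w ⬝ᵥ w ≤ w ⬝ᵥ (H *ᵥ w)) :
    ∃ (l : ι → ℝ) (c : (ι → ℝ) → ι → ℝ), (∀ i, 1 ≤ l i) ∧
      (∀ k : ℕ, (H ^ k).trace = ∑ i, l i ^ k) ∧
      (∀ (k : ℕ) w, w ⬝ᵥ ((H ^ k) *ᵥ w) = ∑ i, l i ^ k * c w i ^ 2) := by
  obtain ⟨O, l, hO, hO', hk⟩ := mc_spec H hH
  refine ⟨l, fun w => Oᵀ *ᵥ w, ?_, ?_, ?_⟩
  · intro i
    have := h1 (O *ᵥ (Pi.single i 1))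
    have hv : Oᵀ *ᵥ (O *ᵥ (Pi.single i (1:ℝ))) = Pi.single i 1 := by
      rw [Matrix.mulVec_mulVec, hO, Matrix.one_mulVec]
    have e0 := mc_quad O (fun i => l i ^ 1) (O *ᵥ (Pi.single i 1))
    have e1 := mc_quad O (fun i => l i ^ 0) (O *ᵥ (Pi.single i 1))
    rw [← hk] at e0 e1
    rw [hv] at e0 e1
    rw [pow_one] at e0
    rw [pow_zero, Matrix.one_mulVec] at e1
    rw [e0, e1] at this
    simpa [Pi.single_apply] using this
  · intro k; rw [hk, mc_tr O hO]
  · intro k w; rw [hk, mc_quad]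

lemma mc_cheb {ι : Type*} [Fintype ι] (l c : ι → ℝ) (hl : ∀ i, 1 ≤ l i) (a b : ℕ) :
    (∑ i, l i ^ a * c i ^ 2) * (∑ i, l i ^ b * c i ^ 2) ≤
      (∑ i, c i ^ 2) * (∑ i, l i ^ (a + b + 1) * c i ^ 2) := by
  have h1 : (∑ i, l i ^ a * c i ^ 2) * (∑ i, l i ^ b * c i ^ 2) ≤
      (∑ i, c i ^ 2) * (∑ i, l i ^ (a + b) * c i ^ 2) := by
    have key : 0 ≤ ∑ i, ∑ j, c i ^ 2 * c j ^ 2 * ((l i ^ a - l j ^ a) * (l i ^ b - l j ^ b)) := by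
      refine Finset.sum_nonneg fun i _ => Finset.sum_nonneg fun j _ => ?_
      refine mul_nonneg (by positivity) ?_
      have hi := hl i
      have hj := hl j
      rcases le_total (l i) (l j) with h | h
      · apply mul_nonneg_of_nonpos_of_nonpos <;> simp only [sub_nonpos] <;> gcongr
      · apply mul_nonneg <;> simp only [sub_nonneg] <;> gcongr
    have e : ∑ i, ∑ j, c i ^ 2 * c j ^ 2 * ((l i ^ a - l j ^ a) * (l i ^ b - l j ^ b)) =
        2 * ((∑ i, c i ^ 2) * (∑ i, l i ^ (a + b) * c i ^ 2)) -
        2 * ((∑ i, l i ^ a * c i ^ 2) * (∑ i, l i ^ b * c i ^ 2)) := by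
      have e1 : ∀ i j, c i ^ 2 * c j ^ 2 * ((l i ^ a - l j ^ a) * (l i ^ b - l j ^ b)) =
         (l i ^ (a+b) * c i ^ 2) * c j ^ 2 + c i ^ 2 * (l j ^ (a+b) * c j ^ 2)
          - (l i ^ a * c i ^2) * (l j ^ b * c j ^ 2) - (l i ^ b * c i ^2) * (l j ^ a * c j ^ 2) := by
        intro i j; rw [pow_add, pow_add]; ring
      simp only [e1, Finset.sum_sub_distrib, Finset.sum_add_distrib, ← Finset.sum_mul_sum]
      ring
    linarith
  refine h1.trans ?_
  refine mul_le_mul_of_nonneg_left (Finset.sum_le_sum fun i _ => ?_) (by positivity)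
  exact mul_le_mul_of_nonneg_right (pow_le_pow_right₀ (hl i) (by omega)) (by positivity)

lemma mc_tel {ι : Type*} [Fintype ι] [DecidableEq ι] (H H' : Matrix ι ι ℝ) (w : ι → ℝ)
    (h : H = H' + vecMulVec w w) (k : ℕ) (v : ι → ℝ):
    (H ^ k) *ᵥ v = (H' ^ k) *ᵥ v + ∑ j ∈ Finset.range k, (w ⬝ᵥ (H ^ (k - 1 - j) *ᵥ v)) • (H' ^ j *ᵥ w) := by
  induction k with
  | zero => simp
  | succ k ih =>
    have e1 : H ^ (k+1) *ᵥ v = H' *ᵥ (H ^ k *ᵥ v) + (w ⬝ᵥ (H ^ k *ᵥ v)) • w := by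
      rw [pow_succ', ← Matrix.mulVec_mulVec]
      nth_rewrite 1 [h]
      rw [Matrix.add_mulVec, Matrix.vecMulVec_mulVec]
      simp
    rw [e1, ih, Finset.sum_range_succ', Matrix.mulVec_add, pow_succ', ← Matrix.mulVec_mulVec, Matrix.mulVec_sum]
    rw [← ih, add_assoc, add_right_inj]
    simp only [pow_zero, Matrix.one_mulVec, Nat.sub_zero, Nat.add_sub_cancel]
    congr 1
    refine Finset.sum_congr rfl fun j hj => ?_
    rw [Matrix.mulVec_smul, pow_succ', ← Matrix.mulVec_mulVec]
    congr 4
    omega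

lemma mc_mix {ι : Type*} [Fintype ι] [DecidableEq ι] (H H' : Matrix ι ι ℝ) (w : ι → ℝ)
    (h : H = H' + vecMulVec w w) (hu : ∀ k : ℕ, 0 ≤ w ⬝ᵥ (H' ^ k *ᵥ w)) (a : ℕ) : ∀ b : ℕ,
    w ⬝ᵥ (H' ^ (a + b) *ᵥ w) ≤ w ⬝ᵥ (H ^ a *ᵥ (H' ^ b *ᵥ w)) := by
  induction a using Nat.strong_induction_on with
  | _ a ih =>
    intro b
    rw [mc_tel H H' w h a, dotProduct_add, Matrix.mulVec_mulVec, ← pow_add, dotProduct_sum]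
    refine le_add_of_nonneg_right (Finset.sum_nonneg fun j hj => ?_)
    rw [dotProduct_smul, smul_eq_mul]
    rw [Finset.mem_range] at hj
    exact mul_nonneg ((hu _).trans (ih (a - 1 - j) (by omega) b)) (hu _)

lemma mc_trace_tel {ι : Type*} [Fintype ι] [DecidableEq ι] (H H' : Matrix ι ι ℝ) (w : ι → ℝ)
    (h : H = H' + vecMulVec w w) (k : ℕ) :
    (H ^ k).trace = (H' ^ k).trace +
      ∑ j ∈ Finset.range k, w ⬝ᵥ (H ^ (k - 1 - j) *ᵥ (H' ^ j *ᵥ w)) := by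
  have e : ∀ i, (H ^ k) i i = (H' ^ k) i i + ∑ j ∈ Finset.range k,
      (w ⬝ᵥ (H ^ (k - 1 - j) *ᵥ Pi.single i 1)) * (H' ^ j *ᵥ w) i := by
    intro i
    have := congrFun (mc_tel H H' w h k (Pi.single i 1)) i
    simpa using this
  simp only [Matrix.trace, Matrix.diag, e, Finset.sum_add_distrib]
  congr 1
  rw [Finset.sum_comm]
  refine Finset.sum_congr rfl fun j _ => ?_
  rw [Matrix.dotProduct_mulVec, dotProduct]
  refine Finset.sum_congr rfl fun i _ => ?_
  rw [Matrix.dotProduct_mulVec]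
  simp

lemma mc_step {ι : Type*} [Fintype ι] [DecidableEq ι] (H H' : Matrix ι ι ℝ) (w : ι → ℝ)
    (h : H = H' + vecMulVec w w) (hH : H.IsHermitian)
    (h1 : ∀ w, w ⬝ᵥ w ≤ w ⬝ᵥ (H *ᵥ w)) (hH' : H'.PosSemidef) (q : ℕ)
    (hq : (q : ℝ) * (w ⬝ᵥ w) ≤ 1 / 2) :
    (H' ^ q).trace ≤ (H ^ q).trace - (q : ℝ) / 2 * (w ⬝ᵥ (H ^ (q - 1) *ᵥ w)) := by
  obtain ⟨l, c, hl, -, hs⟩ := mc_spec2 H hH h1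
  have hu : ∀ k : ℕ, 0 ≤ w ⬝ᵥ (H' ^ k *ᵥ w) := by
    intro k
    have := (hH'.pow k).dotProduct_mulVec_nonneg w
    simpa using this
  have hsn : ∀ k : ℕ, 0 ≤ w ⬝ᵥ (H ^ k *ᵥ w) := by
    intro k; rw [hs]
    exact Finset.sum_nonneg fun i _ => mul_nonneg (pow_nonneg (by linarith [hl i]) _) (sq_nonneg _)
  have hus : ∀ k : ℕ, w ⬝ᵥ (H' ^ k *ᵥ w) ≤ w ⬝ᵥ (H ^ k *ᵥ w) := by
    intro k
    simpa using mc_mix H H' w h hu k 0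
  have hww : w ⬝ᵥ w = ∑ i, c w i ^ 2 := by simpa using hs 0 w
  have hren : ∀ k : ℕ, (w ⬝ᵥ (H ^ k *ᵥ w)) ≤ w ⬝ᵥ (H' ^ k *ᵥ w) + k * (w ⬝ᵥ w) * (w ⬝ᵥ (H ^ k *ᵥ w)) := by
    intro k
    nth_rewrite 1 [mc_tel H H' w h k]
    rw [dotProduct_add, dotProduct_sum]
    have : ∑ i ∈ Finset.range k, w ⬝ᵥ ((w ⬝ᵥ H ^ (k - 1 - i) *ᵥ w) • (H' ^ i *ᵥ w)) ≤
        ∑ i ∈ Finset.range k, (w ⬝ᵥ w) * (w ⬝ᵥ (H ^ k *ᵥ w)) := by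
      refine Finset.sum_le_sum fun j hj => ?_
      rw [Finset.mem_range] at hj
      rw [dotProduct_smul, smul_eq_mul]
      refine (mul_le_mul_of_nonneg_left (hus j) (hsn _)).trans ?_
      rw [hs, hs, hs, hww]
      have := mc_cheb l (c w) hl (k - 1 - j) j
      rwa [show k - 1 - j + j + 1 = k by omega] at this
    rw [Finset.sum_const, Finset.card_range, nsmul_eq_mul] at this
    linarith
  have hw0 : 0 ≤ w ⬝ᵥ w := by rw [hww]; positivity
  have h2 : (w ⬝ᵥ (H ^ (q-1) *ᵥ w)) / 2 ≤ w ⬝ᵥ (H' ^ (q-1) *ᵥ w) := by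
    have a := hren (q-1)
    have b : ((q - 1 : ℕ) : ℝ) * (w ⬝ᵥ w) ≤ 1 / 2 := by
      refine le_trans ?_ hq
      gcongr; omega
    have := mul_le_mul_of_nonneg_right b (hsn (q-1))
    linarith
  have h3 := mc_trace_tel H H' w h q
  have h4 : ∑ j ∈ Finset.range q, w ⬝ᵥ (H' ^ (q-1) *ᵥ w) ≤
      ∑ j ∈ Finset.range q, w ⬝ᵥ (H ^ (q - 1 - j) *ᵥ (H' ^ j *ᵥ w)) := by
    refine Finset.sum_le_sum fun j hj => ?_
    rw [Finset.mem_range] at hj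
    have := mc_mix H H' w h hu (q-1-j) j
    rwa [show q - 1 - j + j = q - 1 by omega] at this
  rw [Finset.sum_const, Finset.card_range, nsmul_eq_mul] at h4
  have h5 := mul_le_mul_of_nonneg_left h2 (Nat.cast_nonneg (α := ℝ) q)
  linarith

def mcW {ι : Type*} (P : Matrix ι ι ℝ) (e : ι) : ι → ℝ := fun i => P i e

def mcH {ι : Type*} [Fintype ι] [DecidableEq ι] (P : Matrix ι ι ℝ) (Om : Finset ι) : Matrix ι ι ℝ :=
  1 + ∑ e ∈ Omᶜ, vecMulVec (mcW P e) (mcW P e)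

lemma mcH_quad {ι : Type*} [Fintype ι] [DecidableEq ι] (P : Matrix ι ι ℝ) (Om : Finset ι) (v : ι → ℝ) :
    v ⬝ᵥ (mcH P Om *ᵥ v) = v ⬝ᵥ v + ∑ e ∈ Omᶜ, (mcW P e ⬝ᵥ v) ^ 2 := by
  rw [mcH, Matrix.add_mulVec, Matrix.one_mulVec, dotProduct_add, Matrix.sum_mulVec, dotProduct_sum]
  congr 1
  refine Finset.sum_congr rfl fun e _ => ?_
  rw [Matrix.vecMulVec_mulVec]
  simp [sq, dotProduct_comm v]

lemma mcH_herm {ι : Type*} [Fintype ι] [DecidableEq ι] (P : Matrix ι ι ℝ) (Om : Finset ι) :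
    (mcH P Om).IsHermitian := by
  rw [Matrix.IsHermitian, conjTranspose_eq_transpose_of_trivial, mcH]
  simp [Matrix.transpose_sum, Matrix.transpose_vecMulVec]

lemma mcH_ge {ι : Type*} [Fintype ι] [DecidableEq ι] (P : Matrix ι ι ℝ) (Om : Finset ι) (v : ι → ℝ) :
    v ⬝ᵥ v ≤ v ⬝ᵥ (mcH P Om *ᵥ v) := by
  rw [mcH_quad]
  have : 0 ≤ ∑ e ∈ Omᶜ, (mcW P e ⬝ᵥ v) ^ 2 := by positivity
  linarith

lemma mcH_psd {ι : Type*} [Fintype ι] [DecidableEq ι] (P : Matrix ι ι ℝ) (Om : Finset ι) :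
    (mcH P Om).PosSemidef := by
  refine Matrix.PosSemidef.of_dotProduct_mulVec_nonneg (mcH_herm P Om) fun v => ?_
  have := mcH_ge P Om v
  have h0 : 0 ≤ v ⬝ᵥ v := by simp only [dotProduct]; exact Finset.sum_nonneg fun i _ => mul_self_nonneg _
  simp; linarith

lemma mcW_self {ι : Type*} [Fintype ι] (P : Matrix ι ι ℝ) (hs : Pᵀ = P)
    (hp : P * P = P) (e : ι) : mcW P e ⬝ᵥ mcW P e = P e e := by
  have := congrFun (congrFun hp e) e
  rw [Matrix.mul_apply] at this
  rw [← this]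
  refine Finset.sum_congr rfl fun i _ => ?_
  have : P i e = P e i := by conv_lhs => rw [← hs, Matrix.transpose_apply]
  simp [mcW, this]

lemma mcH_insert {ι : Type*} [Fintype ι] [DecidableEq ι] (P : Matrix ι ι ℝ) (Om : Finset ι) (e : ι)
    (he : e ∉ Om) : mcH P Om = mcH P (insert e Om) + vecMulVec (mcW P e) (mcW P e) := by
  rw [mcH, mcH, Finset.compl_insert, ← Finset.sum_erase_add _ _ (Finset.mem_compl.2 he), add_assoc]

lemma mc_level {ι : Type*} [Fintype ι] [DecidableEq ι] (P : Matrix ι ι ℝ) (hs : Pᵀ = P)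
    (hp : P * P = P) (η : ℝ) (hη : ∀ e, P e e ≤ η) (q : ℕ) (hq1 : 1 ≤ q) (hq : (q : ℝ) * η ≤ 1 / 2)
    (Om : Finset ι) :
    ∑ e ∈ Omᶜ, (mcH P (insert e Om) ^ q).trace ≤ (Omᶜ.card : ℝ) *
      ((1 - q / (8 * Fintype.card ι)) * (mcH P Om ^ q).trace
        + q / (8 * Fintype.card ι) * ((4 / 3) ^ q * Fintype.card ι)) := by
  set N : ℝ := (Fintype.card ι : ℝ) with hN
  obtain ⟨l, c, hl, ht, -⟩ := mc_spec2 (mcH P Om) (mcH_herm P Om) (mcH_ge P Om)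
  set L := ∑ e ∈ Omᶜ, mcW P e ⬝ᵥ (mcH P Om ^ (q - 1) *ᵥ mcW P e) with hL
  have hLe : L = (mcH P Om ^ q).trace - (mcH P Om ^ (q-1)).trace := by
    have e1 : mcH P Om ^ q = mcH P Om ^ (q - 1) * mcH P Om := by
      rw [← pow_succ]; congr; omega
    have e2 : mcH P Om ^ q = mcH P Om ^ (q-1) + ∑ e ∈ Omᶜ, vecMulVec (mcH P Om ^ (q - 1) *ᵥ (mcW P e)) (mcW P e) := by
      rw [e1]; nth_rewrite 2 [mcH]
      rw [Matrix.mul_add, Matrix.mul_one, Matrix.mul_sum]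
      simp only [Matrix.mul_vecMulVec]
    nth_rewrite 1 [e2]
    rw [Matrix.trace_add, Matrix.trace_sum, hL]
    simp [Matrix.trace_vecMulVec, dotProduct_comm]
  have hLn : 0 ≤ L := by
    rw [hLe, ht, ht, ← Finset.sum_sub_distrib]
    refine Finset.sum_nonneg fun i _ => sub_nonneg.2 (pow_le_pow_right₀ (hl i) (by omega))
  have hL2 : ((mcH P Om ^ q).trace - (4/3)^q * N) / 4 ≤ L := by
    rw [hLe, ht, ht, ← Finset.sum_sub_distrib]
    have : ((4/3)^q * N : ℝ) = ∑ i : ι, (4/3:ℝ)^q := by simp [hN, mul_comm]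
    rw [this, ← Finset.sum_sub_distrib, Finset.sum_div]
    refine Finset.sum_le_sum fun i _ => ?_
    have e1 : l i ^ q = l i * l i ^ (q-1) := by rw [← pow_succ']; congr; omega
    have hp : 0 < l i ^ (q-1) := pow_pos (by linarith [hl i]) _
    rcases le_total (4/3) (l i) with h | h
    · rw [e1]
      have : (0:ℝ) ≤ (4/3)^q := by positivity
      nlinarith
    · have a : l i ^ q ≤ (4/3)^q := pow_le_pow_left₀ (by linarith [hl i]) h _
      have b := pow_le_pow_right₀ (hl i) (show q - 1 ≤ q by omega)
      linarith
  have hstep : ∑ e ∈ Omᶜ, (mcH P (insert e Om) ^ q).trace ≤ (Omᶜ.card : ℝ) * (mcH P Om ^ q).trace - (q:ℝ)/2 * L := by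
    rw [hL, Finset.mul_sum, ← nsmul_eq_mul, ← Finset.sum_const, ← Finset.sum_sub_distrib]
    refine Finset.sum_le_sum fun e he => ?_
    refine mc_step _ _ _ (mcH_insert P Om e (Finset.mem_compl.1 he)) (mcH_herm P Om) (mcH_ge P Om)
      (mcH_psd P _) q ?_
    rw [mcW_self P hs hp]
    exact le_trans (by gcongr; exact hη e) hq
  refine hstep.trans ?_
  have hcN : (Omᶜ.card : ℝ) ≤ N := by rw [hN]; exact_mod_cast Finset.card_le_univ _
  rcases Finset.eq_empty_or_nonempty Omᶜ with h0 | h0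
  · have : L = 0 := by rw [hL, h0]; simp
    rw [this, h0]; simp
  have hc0 : (0:ℝ) < Omᶜ.card := by exact_mod_cast h0.card_pos
  have hNpos : 0 < N := by linarith
  have key : (Omᶜ.card : ℝ) / N * (((mcH P Om ^ q).trace - (4/3)^q * N) / 4) ≤ L := by
    calc _ ≤ (Omᶜ.card : ℝ) / N * L := by gcongr
      _ ≤ 1 * L := by gcongr; rw [div_le_one hNpos]; exact hcN
      _ = L := one_mul _
  have key2 := mul_le_mul_of_nonneg_left key (show (0:ℝ) ≤ q/2 by positivity)
  have : (Omᶜ.card : ℝ) * ((1 - q / (8 * N)) * (mcH P Om ^ q).trace + q / (8 * N) * ((4 / 3) ^ q * N))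
    = (Omᶜ.card : ℝ) * (mcH P Om ^ q).trace - q / 2 * ((Omᶜ.card : ℝ) / N * (((mcH P Om ^ q).trace - (4/3)^q * N) / 4)) := by
    field_simp; ring
  rw [this]; linarith

lemma mc_double {ι : Type*} [Fintype ι] [DecidableEq ι] (f : Finset ι → ℝ) (k : ℕ) :
    ((k + 1 : ℕ) : ℝ) * ∑ Om ∈ Finset.powersetCard (k+1) (Finset.univ : Finset ι), f Om =
      ∑ Om ∈ Finset.powersetCard k (Finset.univ : Finset ι), ∑ e ∈ Omᶜ, f (insert e Om) := by
  have e1 : ((k + 1 : ℕ) : ℝ) * ∑ Om ∈ Finset.powersetCard (k+1) (Finset.univ : Finset ι), f Om =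
     ∑ Om ∈ Finset.powersetCard (k+1) (Finset.univ : Finset ι), ∑ e ∈ Om, f Om := by
    rw [Finset.mul_sum]
    refine Finset.sum_congr rfl fun Om hO => ?_
    rw [Finset.sum_const, (Finset.mem_powersetCard.1 hO).2, nsmul_eq_mul]
  rw [e1, Finset.sum_sigma', Finset.sum_sigma']
  refine Finset.sum_bij' (fun x _ => ⟨x.1.erase x.2, x.2⟩) (fun x _ => ⟨insert x.2 x.1, x.2⟩) ?_ ?_ ?_ ?_ ?_
  · rintro ⟨Om, e⟩ h
    simp only [Finset.mem_sigma, Finset.mem_powersetCard_univ] at h ⊢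
    simp [Finset.card_erase_of_mem h.2, h.1]
  · rintro ⟨Om, e⟩ h
    simp only [Finset.mem_sigma, Finset.mem_powersetCard_univ, Finset.mem_compl] at h ⊢
    simp [Finset.card_insert_of_notMem h.2, h.1]
  · rintro ⟨Om, e⟩ h
    simp only [Finset.mem_sigma, Finset.mem_powersetCard_univ] at h ⊢
    simp [Finset.insert_erase h.2]
  · rintro ⟨Om, e⟩ h
    simp only [Finset.mem_sigma, Finset.mem_powersetCard_univ, Finset.mem_compl] at h ⊢
    simp [Finset.erase_insert h.2]
  · rintro ⟨Om, e⟩ h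
    simp only [Finset.mem_sigma, Finset.mem_powersetCard_univ] at h ⊢
    simp [Finset.insert_erase h.2]

lemma mc_avg {ι : Type*} [Fintype ι] [DecidableEq ι] (P : Matrix ι ι ℝ) (hs : Pᵀ = P)
    (hp : P * P = P) (η : ℝ) (hη : ∀ e, P e e ≤ η) (q : ℕ) (hq1 : 1 ≤ q) (hq : (q : ℝ) * η ≤ 1 / 2)
    (hqN : q ≤ Fintype.card ι) (S : ℕ) (hS : S ≤ Fintype.card ι) :
    ∑ Om ∈ Finset.powersetCard S (Finset.univ : Finset ι), (mcH P Om ^ q).trace ≤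
     ((Fintype.card ι).choose S : ℝ) *
      (2 ^ q * Fintype.card ι * Real.exp (- (q * (S / Fintype.card ι) / 8)) + (4 / 3) ^ q * Fintype.card ι) := by
  set N : ℝ := (Fintype.card ι : ℝ) with hN
  have hNpos : 0 < N := by
    rw [hN]; exact_mod_cast (show 0 < Fintype.card ι by omega)
  have hqN' : (q:ℝ) ≤ N := by rw [hN]; exact_mod_cast hqN
  have hmain : ∀ k : ℕ, k ≤ Fintype.card ι →
     ∑ Om ∈ Finset.powersetCard k (Finset.univ : Finset ι), (mcH P Om ^ q).trace ≤
     ((Fintype.card ι).choose k : ℝ) * (2 ^ q * N * (1 - q / (8 * N)) ^ k + (4 / 3) ^ q * N) := by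
    intro k
    induction k with
    | zero =>
      intro _
      simp only [Finset.powersetCard_zero, Finset.sum_singleton, Nat.choose_zero_right, Nat.cast_one, one_mul, pow_zero, mul_one]
      have e1 : mcH P ∅ = 1 + P := by
        rw [mcH]; congr 1
        ext i j
        rw [Matrix.sum_apply]
        have := congrFun (congrFun hp i) j
        rw [Matrix.mul_apply] at this
        rw [← this]
        simp only [Finset.compl_empty]
        refine Finset.sum_congr rfl fun e _ => ?_
        have : P j e = P e j := by conv_lhs => rw [← hs, Matrix.transpose_apply]
        simp [mcW, vecMulVec_apply, this]
      have e2 : ∀ k : ℕ, (1 + P) ^ k = 1 + (2 ^ k - 1 : ℝ) • P := by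
        intro k
        induction k with
        | zero => simp
        | succ k ih =>
          rw [pow_succ, ih, Matrix.mul_add, Matrix.mul_one, Matrix.add_mul, Matrix.one_mul, Matrix.smul_mul, hp, pow_succ,
            add_assoc, add_right_inj]
          module
      rw [e1, e2, Matrix.trace_add, Matrix.trace_one, Matrix.trace_smul]
      have e3 : P.trace ≤ N := by
        rw [hN, Matrix.trace, ← mul_one (Fintype.card ι : ℝ), ← nsmul_eq_mul, ← Finset.card_univ, ← Finset.sum_const]
        refine Finset.sum_le_sum fun e _ => (hη e).trans ?_
        have : (1:ℝ) ≤ q := by exact_mod_cast hq1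
        by_contra h
        push Not at h
        nlinarith
      have e4 : (1:ℝ) ≤ 2 ^ q := one_le_pow₀ (by norm_num)
      have e5 : (0:ℝ) ≤ (4/3) ^ q * N := by positivity
      rw [smul_eq_mul]
      nlinarith
    | succ k ih =>
      intro hk
      have ih := ih (by omega)
      have hd := mc_double (fun Om => (mcH P Om ^ q).trace) k
      have hkp : (0:ℝ) < ((k+1 : ℕ) : ℝ) := by positivity
      have hch : ((Fintype.card ι).choose (k+1) : ℝ) * ((k+1 : ℕ) : ℝ) = (Fintype.card ι).choose k * ((Fintype.card ι - k : ℕ) : ℝ) := by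
        exact_mod_cast Nat.choose_succ_right_eq _ _
      rw [← mul_le_mul_iff_right₀ hkp, hd, ← mul_assoc, mul_comm ((k+1:ℕ):ℝ), hch]
      have hr : 0 ≤ 1 - q / (8 * N) := by
        rw [sub_nonneg, div_le_one (by positivity)]; linarith
      calc _ ≤ ∑ Om ∈ Finset.powersetCard k (Finset.univ : Finset ι), ((Fintype.card ι - k : ℕ) : ℝ) *
              ((1 - q / (8 * N)) * (mcH P Om ^ q).trace + q / (8 * N) * ((4 / 3) ^ q * N)) := by
            refine Finset.sum_le_sum fun Om hO => ?_
            have h1 := mc_level P hs hp η hη q hq1 hq Om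
            rwa [Finset.card_compl, (Finset.mem_powersetCard.1 hO).2] at h1
        _ = ((Fintype.card ι - k : ℕ) : ℝ) * ((1 - q / (8 * N)) * (∑ Om ∈ Finset.powersetCard k (Finset.univ : Finset ι), (mcH P Om ^ q).trace) + (Fintype.card ι).choose k * (q / (8 * N) * ((4 / 3) ^ q * N))) := by
            rw [← Finset.mul_sum, Finset.sum_add_distrib, ← Finset.mul_sum, Finset.sum_const, Finset.card_powersetCard, Finset.card_univ, nsmul_eq_mul]
        _ ≤ ((Fintype.card ι - k : ℕ) : ℝ) * ((1 - q / (8 * N)) * (((Fintype.card ι).choose k : ℝ) * (2 ^ q * N * (1 - q / (8 * N)) ^ k + (4 / 3) ^ q * N)) + (Fintype.card ι).choose k * (q / (8 * N) * ((4 / 3) ^ q * N))) := by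
            gcongr
        _ = _ := by rw [pow_succ]; ring
  refine (hmain S hS).trans ?_
  have hr : (1 - q / (8 * N)) ^ S ≤ Real.exp (- (q * (S / N) / 8)) := by
    have h1 : 1 - q / (8 * N) ≤ Real.exp (-(q / (8*N))) := by
      have := Real.add_one_le_exp (-(q / (8*N))); linarith
    have hr : 0 ≤ 1 - q / (8 * N) := by
      rw [sub_nonneg, div_le_one (by positivity)]; linarith
    refine (pow_le_pow_left₀ hr h1 S).trans ?_
    rw [← Real.exp_nat_mul]
    apply le_of_eq; congr 1; field_simp
  gcongr

lemma mc_big {ι : Type*} [Fintype ι] [DecidableEq ι] (P : Matrix ι ι ℝ) (hs : Pᵀ = P)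
    (q : ℕ) (Om : Finset ι) (t : ℝ) (ht : t ≤ 1)
    (a : ι → ℝ) (ha : P *ᵥ a = a) (hlt : ∑ e ∈ Om, a e ^ 2 < t * ∑ e, a e ^ 2) :
    (2 - t) ^ q ≤ (mcH P Om ^ q).trace := by
  obtain ⟨l, c, hl, htr, hqd⟩ := mc_spec2 (mcH P Om) (mcH_herm P Om) (mcH_ge P Om)
  have hw : ∀ e, mcW P e ⬝ᵥ a = a e := by
    intro e
    have := congrFun ha e
    rw [← this]
    simp only [mcW, dotProduct, Matrix.mulVec]
    refine Finset.sum_congr rfl fun i _ => ?_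
    have : P i e = P e i := by conv_lhs => rw [← hs, Matrix.transpose_apply]
    rw [this]
  have h0 : a ⬝ᵥ a = ∑ e, a e ^ 2 := by simp [dotProduct, sq]
  have h1 := mcH_quad P Om a
  have h2 := Finset.sum_add_sum_compl Om (fun e => a e ^ 2)
  simp only [hw] at h1
  have h3 := hqd 1 a
  have h4 := hqd 0 a
  simp only [pow_one, pow_zero, Matrix.one_mulVec, one_mul] at h3 h4
  have h5 : ∃ i, 2 - t < l i := by
    by_contra hcon
    push Not at hcon
    have : ∑ i, l i * c a i ^ 2 ≤ ∑ i, (2 - t) * c a i ^ 2 :=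
      Finset.sum_le_sum fun i _ => mul_le_mul_of_nonneg_right (hcon i) (sq_nonneg _)
    rw [← Finset.mul_sum, ← h4, ← h3] at this
    rw [h1, h0] at this
    nlinarith
  obtain ⟨i, hi⟩ := h5
  rw [htr]
  calc (2 - t) ^ q ≤ l i ^ q := pow_le_pow_left₀ (by linarith) hi.le _
    _ ≤ _ := Finset.single_le_sum (f := fun i => l i ^ q) (fun j _ => pow_nonneg (by linarith [hl j]) _) (Finset.mem_univ i)

lemma mc_tangent {ι : Type*} [Fintype ι] [DecidableEq ι] (P : Matrix ι ι ℝ) (hs : Pᵀ = P)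
    (hp : P * P = P) (η : ℝ) (hη : ∀ e, P e e ≤ η) (q : ℕ) (hq1 : 1 ≤ q) (hq : (q : ℝ) * η ≤ 1 / 2)
    (hqN : q ≤ Fintype.card ι) (S : ℕ) (hS : S ≤ Fintype.card ι) (p : ℝ) (hpS : p = S / Fintype.card ι) :
    (((Finset.powersetCard S (Finset.univ : Finset ι)).filter (fun Om =>
      ∃ a : ι → ℝ, P *ᵥ a = a ∧ ∑ e ∈ Om, a e ^ 2 < p / 16 * ∑ e, a e ^ 2)).card : ℝ) ≤
     2 * Fintype.card ι * Real.exp (- (q * p / 16)) * ((Fintype.card ι).choose S : ℝ) := by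
  set N : ℝ := (Fintype.card ι : ℝ) with hN
  have hNpos : 0 < N := by
    rw [hN]; exact_mod_cast (show 0 < Fintype.card ι by omega)
  have hp0 : 0 ≤ p := by rw [hpS]; positivity
  have hp1 : p ≤ 1 := by
    rw [hpS, div_le_one hNpos, hN]; exact_mod_cast hS
  have hav := mc_avg P hs hp η hη q hq1 hq hqN S hS
  rw [← hN, ← hpS] at hav
  set B := (Finset.powersetCard S (Finset.univ : Finset ι)).filter (fun Om =>
      ∃ a : ι → ℝ, P *ᵥ a = a ∧ ∑ e ∈ Om, a e ^ 2 < p / 16 * ∑ e, a e ^ 2) with hB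
  have h1 : (B.card : ℝ) * (2 - p/16) ^ q ≤ ∑ Om ∈ Finset.powersetCard S (Finset.univ : Finset ι), (mcH P Om ^ q).trace := by
    calc (B.card : ℝ) * (2 - p/16) ^ q = ∑ Om ∈ B, (2 - p/16) ^ q := by simp
      _ ≤ ∑ Om ∈ B, (mcH P Om ^ q).trace := by
        refine Finset.sum_le_sum fun Om hO => ?_
        obtain ⟨-, a, ha, hlt⟩ := Finset.mem_filter.1 hO
        exact mc_big P hs q Om (p/16) (by linarith) a ha hlt
      _ ≤ _ := by
        refine Finset.sum_le_sum_of_subset_of_nonneg (Finset.filter_subset _ _) fun Om _ _ => ?_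
        exact ((mcH_psd P Om).pow q).trace_nonneg
  have h2 : 0 < (2 - p/16) ^ q := pow_pos (by linarith) _
  rw [← mul_le_mul_iff_left₀ h2]
  refine (h1.trans hav).trans ?_
  have hexp : Real.exp (-(p / 16)) ≤ 1 - p / 32 := by
    have := Real.exp_bound_div_one_sub_of_interval (x := p/16) (by positivity) (by linarith)
    have h3 : Real.exp (-(p/16)) * (1 + p/16) ≤ 1 := by
      have a := Real.add_one_le_exp (p/16)
      have b : Real.exp (-(p/16)) * Real.exp (p/16) = 1 := by rw [← Real.exp_add]; simp
      have := Real.exp_pos (-(p/16))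
      nlinarith
    have := Real.exp_pos (-(p/16))
    by_contra h
    push Not at h
    nlinarith
  have hx : Real.exp (-(q * p / 16)) = Real.exp (-(p/16)) ^ q := by
    rw [← Real.exp_nat_mul]; congr 1; ring
  have hx8 : Real.exp (-(q * p / 8)) = Real.exp (-(p/16)) ^ q * Real.exp (-(p/16)) ^ q := by
    rw [← Real.exp_nat_mul, ← Real.exp_add]; congr 1; ring
  have e1 : Real.exp (-(q*p/8)) * 2 ^ q ≤ Real.exp (-(q * p / 16)) * (2 - p/16)^q := by
    rw [hx, hx8, mul_assoc]
    gcongr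
    rw [← mul_pow]
    exact pow_le_pow_left₀ (by positivity) (by linarith) _
  have e2 : ((4:ℝ)/3) ^ q ≤ Real.exp (-(q * p / 16)) * (2 - p/16)^q := by
    rw [hx, ← mul_pow]
    refine pow_le_pow_left₀ (by positivity) ?_ _
    have : 1 - p/16 ≤ Real.exp (-(p/16)) := by linarith [Real.add_one_le_exp (-(p/16))]
    nlinarith
  have hc : (0:ℝ) ≤ ((Fintype.card ι).choose S : ℝ) := by positivity
  calc _ = ((Fintype.card ι).choose S : ℝ) * N * (Real.exp (-(q*p/8)) * 2 ^ q + (4/3)^q) := by ring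
    _ ≤ ((Fintype.card ι).choose S : ℝ) * N * (Real.exp (-(q * p / 16)) * (2 - p/16)^q + Real.exp (-(q * p / 16)) * (2 - p/16)^q) := by gcongr
    _ = _ := by ring

lemma mc_E1 {m n r : ℕ} (μ : ℝ) (Uh : Matrix (Fin m) (Fin r) ℝ) (Vh : Matrix (Fin n) (Fin r) ℝ)
    (hU : Uhᵀ * Uh = 1) (hV : Vhᵀ * Vh = 1)
    (hUi : ∀ i, ∑ k, Uh i k ^ 2 ≤ μ * r / m) (hVj : ∀ j, ∑ k, Vh j k ^ 2 ≤ μ * r / n)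
    (q : ℕ) (hq1 : 1 ≤ q) (hq : (q : ℝ) * (μ * r / m + μ * r / n) ≤ 1 / 2)
    (hqN : q ≤ m * n) (S : ℕ) (hS : S ≤ m * n) (p : ℝ) (hpS : p = S / (m * n)) :
    (((Finset.powersetCard S (Finset.univ : Finset (Fin m × Fin n))).filter (fun Om =>
      ∃ A : Matrix (Fin m) (Fin n) ℝ, (1 - Uh * Uhᵀ) * A * (1 - Vh * Vhᵀ) = 0 ∧
       ∑ e ∈ Om, A e.1 e.2 ^ 2 < p / 16 * ∑ i, ∑ j, A i j ^ 2)).card : ℝ) ≤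
     2 * (m * n) * Real.exp (- (q * p / 16)) * ((m * n).choose S : ℝ) := by
  set PU := 1 - Uh * Uhᵀ with hPU
  set PV := 1 - Vh * Vhᵀ with hPV
  have pu1 : PUᵀ = PU := by simp [hPU]
  have pv1 : PVᵀ = PV := by simp [hPV]
  have pu2 : PU * PU = PU := by
    have : Uh * Uhᵀ * (Uh * Uhᵀ) = Uh * Uhᵀ := by
      rw [Matrix.mul_assoc, ← Matrix.mul_assoc Uhᵀ, hU, Matrix.one_mul]
    rw [hPU]; simp [Matrix.mul_sub, Matrix.sub_mul, this]
  have pv2 : PV * PV = PV := by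
    have : Vh * Vhᵀ * (Vh * Vhᵀ) = Vh * Vhᵀ := by
      rw [Matrix.mul_assoc, ← Matrix.mul_assoc Vhᵀ, hV, Matrix.one_mul]
    rw [hPV]; simp [Matrix.mul_sub, Matrix.sub_mul, this]
  set P : Matrix (Fin m × Fin n) (Fin m × Fin n) ℝ := 1 - kroneckerMap (· * ·) PU PV with hP
  have hPs : Pᵀ = P := by
    rw [hP, Matrix.transpose_sub, ← Matrix.kroneckerMap_transpose, pu1, pv1, Matrix.transpose_one]
  have hkk : kroneckerMap (· * ·) PU PV * kroneckerMap (· * ·) PU PV = kroneckerMap (· * ·) PU PV := by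
    have := Matrix.mul_kronecker_mul PU PU PV PV
    rw [pu2, pv2] at this
    exact this.symm
  have hPp : P * P = P := by
    rw [hP, Matrix.mul_sub, Matrix.sub_mul, Matrix.sub_mul, hkk]; simp
  have hdiag : ∀ e, P e e ≤ μ * r / m + μ * r / n := by
    rintro ⟨i, j⟩
    have a := hUi i
    have b := hVj j
    have a0 : 0 ≤ ∑ k, Uh i k ^ 2 := by positivity
    have b0 : 0 ≤ ∑ k, Vh j k ^ 2 := by positivity
    have e1 : P (i,j) (i,j) = 1 - (1 - ∑ k, Uh i k ^ 2) * (1 - ∑ k, Vh j k ^ 2) := by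
      simp [hP, hPU, hPV, Matrix.mul_apply, sq]
    rw [e1]; nlinarith
  have hc : Fintype.card (Fin m × Fin n) = m * n := by simp
  have main := mc_tangent P hPs hPp _ hdiag q hq1 hq (by rwa [hc]) S (by rwa [hc]) p (by rw [hpS, hc]; simp)
  rw [hc, Nat.cast_mul] at main
  refine le_trans ?_ main
  rw [Nat.cast_le]
  refine Finset.card_le_card ?_
  intro Om hO
  rw [Finset.mem_filter] at hO ⊢
  obtain ⟨h1, A, hA, hlt⟩ := hO
  refine ⟨h1, fun e => A e.1 e.2, ?_, ?_⟩
  · rw [hP, Matrix.sub_mulVec, Matrix.one_mulVec]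
    rw [sub_eq_self]
    ext ⟨i, j⟩
    have := congrFun (congrFun hA i) j
    rw [Matrix.mul_apply] at this
    simp only [Matrix.mul_apply, Finset.sum_mul] at this
    simp only [Matrix.mulVec, dotProduct, Fintype.sum_prod_type, Matrix.kroneckerMap_apply, Pi.zero_apply]
    rw [Finset.sum_comm]
    rw [Matrix.zero_apply] at this
    rw [← this]
    refine Finset.sum_congr rfl fun k _ => Finset.sum_congr rfl fun l _ => ?_
    have : PV j k = PV k j := by conv_lhs => rw [← pv1, Matrix.transpose_apply]
    rw [this]; ring
  · rw [Fintype.sum_prod_type]; exact hlt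

lemma mc_choose_ratio (N S k : ℕ) (hS : S ≤ N) (hk : k ≤ S) :
    ((N - k).choose (S - k) : ℝ) ≤ (S / N : ℝ) ^ k * (N.choose S : ℝ) := by
  induction k with
  | zero => simp
  | succ k ih =>
    have ih := ih (by omega)
    have e := Nat.add_one_mul_choose_eq (N - (k+1)) (S - (k+1))
    rw [show N - (k+1) + 1 = N - k by omega, show S - (k+1) + 1 = S - k by omega] at e
    have e' : ((N - k : ℕ) : ℝ) * ((N - (k+1)).choose (S - (k+1)) : ℝ) = ((N-k).choose (S-k) : ℝ) * ((S - k : ℕ) : ℝ) := by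
      exact_mod_cast e
    have hpos : (0:ℝ) < ((N - k : ℕ) : ℝ) := by exact_mod_cast (show 0 < N - k by omega)
    have hN : (0:ℝ) < N := by exact_mod_cast (show 0 < N by omega)
    have e2 : ((N - (k+1)).choose (S - (k+1)) : ℝ) = (((S - k : ℕ) : ℝ) / ((N - k : ℕ) : ℝ)) * ((N-k).choose (S-k) : ℝ) := by
      field_simp; linarith
    have e3 : (((S - k : ℕ) : ℝ) / ((N - k : ℕ) : ℝ)) ≤ S / N := by
      rw [div_le_div_iff₀ hpos hN, Nat.cast_sub (by omega), Nat.cast_sub (by omega)]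
      have : (S:ℝ) ≤ N := by exact_mod_cast hS
      have : (0:ℝ) ≤ k := by positivity
      nlinarith
    rw [e2, pow_succ', mul_assoc]
    gcongr

lemma mc_count {ι : Type*} [Fintype ι] [DecidableEq ι] (S k : ℕ) (hS : S ≤ Fintype.card ι)
    (hk : 1 ≤ k) (D : Finset ι) :
    (((Finset.powersetCard S (Finset.univ : Finset ι)).filter (fun Om => k ≤ (Om ∩ D).card)).card : ℝ) ≤
      (Real.exp 1 * ((S / Fintype.card ι) * D.card) / k) ^ k * ((Fintype.card ι).choose S : ℝ) := by
  by_cases hkS : k ≤ S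
  swap
  · have : (Finset.powersetCard S (Finset.univ : Finset ι)).filter (fun Om => k ≤ (Om ∩ D).card) = ∅ := by
      rw [Finset.filter_eq_empty_iff]
      intro Om hO h
      have := Finset.card_le_card (Finset.inter_subset_left (s₁ := Om) (s₂ := D))
      rw [(Finset.mem_powersetCard.1 hO).2] at this
      omega
    rw [this]; simp; positivity
  have h1 : ((Finset.powersetCard S (Finset.univ : Finset ι)).filter (fun Om => k ≤ (Om ∩ D).card)) ⊆
      (Finset.powersetCard k D).biUnion (fun T => (Finset.powersetCard S (Finset.univ : Finset ι)).filter (fun Om => T ⊆ Om)) := by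
    intro Om hO
    rw [Finset.mem_filter] at hO
    obtain ⟨T, hT, hTc⟩ := Finset.exists_subset_card_eq hO.2
    rw [Finset.mem_biUnion]
    refine ⟨T, Finset.mem_powersetCard.2 ⟨hT.trans Finset.inter_subset_right, hTc⟩, ?_⟩
    rw [Finset.mem_filter]
    exact ⟨hO.1, hT.trans Finset.inter_subset_left⟩
  have h2 : ∀ T ∈ Finset.powersetCard k D, ((Finset.powersetCard S (Finset.univ : Finset ι)).filter (fun Om => T ⊆ Om)).card ≤ (Fintype.card ι - k).choose (S - k) := by
    intro T hT
    have hTc := (Finset.mem_powersetCard.1 hT).2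
    have : (Finset.powersetCard (S - k) Tᶜ).card = (Fintype.card ι - k).choose (S - k) := by
      rw [Finset.card_powersetCard, Finset.card_compl, hTc]
    rw [← this]
    refine Finset.card_le_card_of_injOn (fun Om => Om \ T) ?_ ?_
    · intro Om hO
      simp only [Finset.coe_filter, Set.mem_setOf_eq, Finset.mem_powersetCard_univ] at hO
      simp only [Finset.mem_coe, Finset.mem_powersetCard]
      refine ⟨fun x hx => by simp at hx ⊢; exact hx.2, ?_⟩
      rw [Finset.card_sdiff_of_subset hO.2, hO.1, hTc]
    · intro Om hO Om' hO' h
      simp only [Finset.coe_filter, Set.mem_setOf_eq] at hO hO'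
      simp only at h
      rw [← Finset.sdiff_union_of_subset hO.2, h, Finset.sdiff_union_of_subset hO'.2]
  have h3 : ((Finset.powersetCard S (Finset.univ : Finset ι)).filter (fun Om => k ≤ (Om ∩ D).card)).card ≤ D.card.choose k * (Fintype.card ι - k).choose (S - k) := by
    refine (Finset.card_le_card h1).trans ?_
    refine (Finset.card_biUnion_le_card_mul _ _ _ h2).trans ?_
    rw [Finset.card_powersetCard]
  have h4 : (D.card.choose k : ℝ) ≤ (Real.exp 1 * D.card / k) ^ k := by
    refine (Nat.choose_le_pow_div (α := ℝ) k D.card).trans ?_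
    have hk0 : (0:ℝ) < k := by exact_mod_cast hk
    have := Real.pow_div_factorial_le_exp (k:ℝ) hk0.le k
    rw [div_pow, mul_pow, ← Real.exp_nat_mul, mul_one]
    rw [div_le_iff₀ (by positivity)] at this ⊢
    rw [div_mul_eq_mul_div, le_div_iff₀ (by positivity)]
    nlinarith [show (0:ℝ) ≤ (D.card:ℝ)^k by positivity]
  calc _ ≤ ((D.card.choose k * (Fintype.card ι - k).choose (S - k) : ℕ) : ℝ) := by exact_mod_cast h3
    _ = (D.card.choose k : ℝ) * ((Fintype.card ι - k).choose (S - k) : ℝ) := by push_cast; ring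
    _ ≤ (Real.exp 1 * D.card / k) ^ k * ((S / Fintype.card ι : ℝ) ^ k * ((Fintype.card ι).choose S : ℝ)) := by
      gcongr
      exact mc_choose_ratio _ _ _ hS hkS
    _ = _ := by rw [← mul_assoc, ← mul_pow]; congr 2; ring

lemma mc_e2 : Real.exp 2 ≤ 8 := by
  have : Real.exp 2 = Real.exp 1 ^ 2 := by rw [← Real.exp_nat_mul]; norm_num
  rw [this]
  have := Real.exp_one_lt_d9
  have := Real.exp_pos 1
  nlinarith

lemma mc_tail {ι : Type*} [Fintype ι] [DecidableEq ι] (S : ℕ) (hS : S ≤ Fintype.card ι)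
    (D : Finset ι) (t L : ℝ) (ht : 0 < t) (hD : 0 < (S / Fintype.card ι : ℝ) * D.card)
    (hL : ∀ k : ℝ, t ≤ k → L ≤ k * Real.log (k / (Real.exp 1 * ((S / Fintype.card ι) * D.card)))) :
    (((Finset.powersetCard S (Finset.univ : Finset ι)).filter (fun Om => t < (Om ∩ D).card)).card : ℝ) ≤
      Real.exp (-L) * ((Fintype.card ι).choose S : ℝ) := by
  have hk : 1 ≤ ⌈t⌉₊ := Nat.one_le_ceil_iff.2 ht
  have h := mc_count S ⌈t⌉₊ hS hk D
  have h0 : (Finset.powersetCard S (Finset.univ : Finset ι)).filter (fun Om => t < (Om ∩ D).card) ⊆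
     (Finset.powersetCard S (Finset.univ : Finset ι)).filter (fun Om => ⌈t⌉₊ ≤ (Om ∩ D).card) := by
    intro Om hO
    rw [Finset.mem_filter] at hO ⊢
    exact ⟨hO.1, Nat.ceil_le.2 hO.2.le⟩
  have h1 := Finset.card_le_card h0
  refine (Nat.cast_le.2 h1).trans (h.trans ?_)
  gcongr
  have hl := hL ⌈t⌉₊ (Nat.le_ceil t)
  have hk0 : (0:ℝ) < (⌈t⌉₊ : ℝ) := by exact_mod_cast hk
  set z := Real.exp 1 * ((S / Fintype.card ι : ℝ) * D.card) with hz
  have hz0 : 0 < z := by positivity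
  have : z / (⌈t⌉₊:ℝ) = Real.exp (- Real.log (⌈t⌉₊ / z)) := by
    rw [Real.exp_neg, Real.exp_log (by positivity), inv_div]
  rw [this, ← Real.exp_nat_mul]
  gcongr
  linarith

lemma mc_tail_simple {ι : Type*} [Fintype ι] [DecidableEq ι] (S : ℕ) (hS : S ≤ Fintype.card ι)
    (D : Finset ι) (hD : 0 < (S / Fintype.card ι : ℝ) * D.card) :
    (((Finset.powersetCard S (Finset.univ : Finset ι)).filter (fun Om => 8 * ((S / Fintype.card ι : ℝ) * D.card) < (Om ∩ D).card)).card : ℝ) ≤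
      Real.exp (-(8 * ((S / Fintype.card ι : ℝ) * D.card))) * ((Fintype.card ι).choose S : ℝ) := by
  refine mc_tail S hS D _ _ (by positivity) hD ?_
  intro k hk
  set z := ((S / Fintype.card ι : ℝ) * D.card) with hz
  have : 1 ≤ Real.log (k / (Real.exp 1 * z)) := by
    rw [Real.le_log_iff_exp_le (by have : 0 < k := by linarith
                                   positivity), le_div_iff₀ (by positivity), ← mul_assoc, ← Real.exp_add]
    norm_num
    nlinarith [mc_e2]
  nlinarith

lemma mc_mono (a A m : ℝ) (ha : 0 < a) (hA : a ≤ A) (hm : A ≤ m) :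
    a * Real.log (Real.exp 1 * m / a) ≤ A * Real.log (Real.exp 1 * m / A) := by
  have hA0 : 0 < A := by linarith
  have hm0 : 0 < m := by linarith
  have e1 : Real.log (Real.exp 1 * m / A) = Real.log (Real.exp 1 * m / a) - Real.log (A / a) := by
    rw [← Real.log_div (by positivity) (by positivity)]
    congr 1; field_simp
  have e2 : 1 + Real.log (A/a) ≤ Real.log (Real.exp 1 * m / a) := by
    have : (1:ℝ) = Real.log (Real.exp 1) := by simp
    rw [this, ← Real.log_mul (by positivity) (by positivity)]
    refine Real.log_le_log (by positivity) ?_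
    rw [mul_div_assoc]; simp; gcongr
  have e3 : Real.log (A/a) ≤ A/a - 1 := Real.log_le_sub_one_of_pos (by positivity)
  rw [e1]
  set u := A / a with hu
  have hAu : A = u * a := by rw [hu]; field_simp
  have hu1 : 1 ≤ u := by rw [hu, le_div_iff₀ ha]; linarith
  rw [hAu]
  set l := Real.log (Real.exp 1 * m / a)
  set w := Real.log u
  have : l ≤ u * (l - w) := by nlinarith
  nlinarith

lemma mc_rate (A m z k : ℝ) (hA : 0 < A) (hAm : A ≤ m)
    (hz : 0 < z) (hzk : 8 * z ≤ k) (hz2 : 100 * m * z ≤ k ^ 2) (hkA : 10 * A ≤ k) :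
    10 * (A * Real.log (Real.exp 1 * m / A)) ≤ k * Real.log (k / (Real.exp 1 * z)) := by
  have hk0 : 0 < k := by linarith
  have hm0 : 0 < m := by linarith
  have e1 : Real.log (Real.exp 1 * m / A) = 1 + Real.log (m / A) := by
    rw [mul_div_assoc, Real.log_mul (by positivity) (by positivity), Real.log_exp]
  have e2 : Real.log (m/A) ≤ m/A - 1 := Real.log_le_sub_one_of_pos (by positivity)
  have e3 : A * Real.log (Real.exp 1 * m / A) ≤ m := by
    rw [e1]
    have : A * (m/A) = m := by field_simp
    nlinarith
  by_cases h : 10 * m ≤ k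
  · have : 1 ≤ Real.log (k / (Real.exp 1 * z)) := by
      rw [Real.le_log_iff_exp_le (by positivity), le_div_iff₀ (by positivity), ← mul_assoc, ← Real.exp_add]
      norm_num
      nlinarith [mc_e2]
    nlinarith
  push Not at h
  set L := Real.log (Real.exp 1 * m / A) with hL
  set w := Real.log (k / (10 * A)) with hw
  have w0 : 0 ≤ w := Real.log_nonneg (by rw [le_div_iff₀ (by positivity)]; linarith)
  have w1 : 1 + w ≤ L := by
    rw [e1]
    have : w ≤ Real.log (m/A) := by
      refine Real.log_le_log (by positivity) ?_
      rw [div_le_div_iff₀ (by positivity) (by positivity)]; nlinarith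
    linarith
  have w2 : 10 * A * (1 + w) ≤ k := by
    have : w ≤ k/(10*A) - 1 := Real.log_le_sub_one_of_pos (by positivity)
    have h2 : 10 * A * (k/(10*A)) = k := by field_simp
    nlinarith
  have w3 : L - w ≤ Real.log (k / (Real.exp 1 * z)) := by
    rw [hL, hw, ← Real.log_div (by positivity) (by positivity)]
    refine Real.log_le_log (by positivity) ?_
    rw [div_div_eq_mul_div, div_le_div_iff₀ hk0 (by positivity)]
    have : Real.exp 1 * m / A * (10 * A) * (Real.exp 1 * z) = Real.exp 2 * (10 * m * z) := by
      have : Real.exp 2 = Real.exp 1 * Real.exp 1 := by rw [← Real.exp_add]; norm_num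
      rw [this]; field_simp
    rw [this]
    have := mc_e2
    have : 0 < m * z := by positivity
    nlinarith
  calc 10 * (A * L) ≤ (10 * A * (1 + w)) * (L - w) := by nlinarith [mul_nonneg (mul_nonneg hA.le w0) (show 0 ≤ L - 1 - w by linarith)]
    _ ≤ k * (L - w) := by gcongr; linarith
    _ ≤ _ := by gcongr

/-- sum over nonempty subsets -/
lemma mc_sumset (m : ℕ) (hm : 1 ≤ m) :
    ∑ I : Finset (Fin m), (if I.card = 0 then (0:ℝ) else Real.exp (-(5 * (I.card * Real.log (Real.exp 1 * m / I.card))))) ≤ Real.exp (-4) / (m:ℝ)^3 := by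
  have hm0 : (0:ℝ) < m := by exact_mod_cast hm
  have h := Finset.sum_powerset_apply_card (fun a : ℕ => (if a = 0 then (0:ℝ) else Real.exp (-(5 * (a * Real.log (Real.exp 1 * m / a)))))) (x := (Finset.univ : Finset (Fin m)))
  rw [Finset.powerset_univ] at h
  rw [h, Finset.sum_range_succ']
  simp only [Finset.card_univ, Fintype.card_fin, if_true, smul_zero, add_zero]
  have : ∀ a ∈ Finset.range m, (m.choose (a+1)) • (if a + 1 = 0 then (0:ℝ) else Real.exp (-(5 * ((a+1:ℕ) * Real.log (Real.exp 1 * m / (a+1:ℕ)))))) ≤ Real.exp (-4) / (m:ℝ)^4 := by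
    intro a ha
    have ha := Finset.mem_range.1 ha
    rw [if_neg (by omega)]
    set b : ℕ := a + 1 with hb
    have hb0 : (0:ℝ) < b := by positivity
    have hb1 : (1:ℝ) ≤ b := by exact_mod_cast (show 1 ≤ b by omega)
    have hbm : (b:ℝ) ≤ m := by exact_mod_cast (show b ≤ m by omega)
    have h4 : (m.choose b : ℝ) ≤ Real.exp (b * Real.log (Real.exp 1 * m / b)) := by
      have : (m.choose b : ℝ) ≤ (Real.exp 1 * m / b) ^ b := by
        refine (Nat.choose_le_pow_div (α := ℝ) b m).trans ?_
        have := Real.pow_div_factorial_le_exp (b:ℝ) hb0.le b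
        rw [div_pow, mul_pow, ← Real.exp_nat_mul, mul_one]
        rw [div_le_iff₀ (by positivity)] at this ⊢
        rw [div_mul_eq_mul_div, le_div_iff₀ (by positivity)]
        nlinarith [show (0:ℝ) ≤ (m:ℝ)^b by positivity]
      rw [Real.exp_nat_mul, Real.exp_log (by positivity)]
      exact this
    have h5 := mc_mono 1 b m one_pos hb1 hbm
    rw [div_one, one_mul, Real.log_mul (by positivity) (by positivity), Real.log_exp] at h5
    set f := (b:ℝ) * Real.log (Real.exp 1 * m / b)
    rw [nsmul_eq_mul]
    calc _ ≤ Real.exp f * Real.exp (-(5*f)) := by gcongr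
      _ = Real.exp (-(4*f)) := by rw [← Real.exp_add]; ring_nf
      _ ≤ Real.exp (-(4 + 4*Real.log m)) := by gcongr; linarith
      _ = _ := by
        rw [neg_add, Real.exp_add, Real.exp_neg (4 * Real.log m), div_eq_mul_inv]
        congr 2
        rw [show (4:ℝ) = ((4:ℕ):ℝ) by norm_num, Real.exp_nat_mul, Real.exp_log hm0]
  refine (Finset.sum_le_sum this).trans ?_
  simp
  field_simp
  exact le_rfl

set_option maxHeartbeats 1600000 in
lemma mc_pair (m n S : ℕ) (hn : 1 ≤ n) (hnm : n ≤ m) (hS : S ≤ m * n) (hS0 : 0 < S) (p : ℝ)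
    (hp : p = (S:ℝ) / (m * n)) (I : Finset (Fin m)) (J : Finset (Fin n)) (hI : I.card ≠ 0) (hJ : J.card ≠ 0) :
    (((Finset.powersetCard S (Finset.univ : Finset (Fin m × Fin n))).filter (fun Om =>
      (∀ i, ((Om ∩ ({i} ×ˢ Finset.univ)).card : ℝ) ≤ 8 * (p * n)) ∧
      (∀ j, ((Om ∩ (Finset.univ ×ˢ {j})).card : ℝ) ≤ 8 * (p * m)) ∧
      8 * (p * (I.card * J.card)) + 10 * Real.sqrt (p * m * (I.card * J.card)) < ((Om ∩ (I ×ˢ J)).card : ℝ))).card : ℝ) ≤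
     Real.exp (-(5 * (I.card * Real.log (Real.exp 1 * m / I.card)))) *
     Real.exp (-(5 * (J.card * Real.log (Real.exp 1 * n / J.card)))) * ((m * n).choose S : ℝ) := by
  have hm0 : (0:ℝ) < m := by exact_mod_cast (show 0 < m by omega)
  have hn0 : (0:ℝ) < n := by exact_mod_cast (show 0 < n by omega)
  have hnm' : (n:ℝ) ≤ m := by exact_mod_cast hnm
  have hp0 : 0 < p := by rw [hp]; positivity
  have ha0 : (0:ℝ) < I.card := by exact_mod_cast Nat.pos_of_ne_zero hI
  have hb0 : (0:ℝ) < J.card := by exact_mod_cast Nat.pos_of_ne_zero hJ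
  have ham : (I.card : ℝ) ≤ m := by exact_mod_cast (by simpa using Finset.card_le_univ I : I.card ≤ m)
  have hbn : (J.card : ℝ) ≤ n := by exact_mod_cast (by simpa using Finset.card_le_univ J : J.card ≤ n)
  have hcard : (Fintype.card (Fin m × Fin n)) = m * n := by simp
  set a : ℝ := (I.card : ℝ) with ha
  set b : ℝ := (J.card : ℝ) with hb
  set ab : ℝ := (m:ℝ)/n * b with hab
  have hab0 : 0 < ab := by positivity
  have habm : ab ≤ m := by
    rw [hab, div_mul_eq_mul_div, div_le_iff₀ hn0]; gcongr
  set A := max a ab with hA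
  set A' := min a ab with hA'
  have hA0 : 0 < A := lt_max_of_lt_left ha0
  have hA'0 : 0 < A' := lt_min ha0 hab0
  have hAm : A ≤ m := max_le ham habm
  have hAA : A * A' = a * ab := max_mul_min a ab
  have hprod : p * m * (a * b) = p * n * (A * A') := by
    rw [hAA, hab]; field_simp
  by_cases hC : 10 * Real.sqrt (p * m * (a * b)) < 8 * (p * n * A')
  swap
  · have : (Finset.powersetCard S (Finset.univ : Finset (Fin m × Fin n))).filter (fun Om =>
      (∀ i, ((Om ∩ ({i} ×ˢ Finset.univ)).card : ℝ) ≤ 8 * (p * n)) ∧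
      (∀ j, ((Om ∩ (Finset.univ ×ˢ {j})).card : ℝ) ≤ 8 * (p * m)) ∧
      8 * (p * (a * b)) + 10 * Real.sqrt (p * m * (a * b)) < ((Om ∩ (I ×ˢ J)).card : ℝ)) = ∅ := by
      rw [Finset.filter_eq_empty_iff]
      rintro Om hO ⟨h1, h2, h3⟩
      apply hC
      have e1 : ((Om ∩ (I ×ˢ J)).card : ℝ) ≤ 8 * (p * n) * a := by
        have s1 : Om ∩ (I ×ˢ J) ⊆ I.biUnion (fun i => Om ∩ ({i} ×ˢ Finset.univ)) := by
          intro e he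
          simp only [Finset.mem_inter, Finset.mem_product] at he
          simp only [Finset.mem_biUnion, Finset.mem_inter, Finset.mem_product, Finset.mem_singleton, Finset.mem_univ, and_true]
          exact ⟨e.1, he.2.1, he.1, rfl⟩
        have s2 := (Finset.card_le_card s1).trans Finset.card_biUnion_le
        calc ((Om ∩ (I ×ˢ J)).card : ℝ) ≤ ∑ i ∈ I, ((Om ∩ ({i} ×ˢ Finset.univ)).card : ℝ) := by exact_mod_cast s2
          _ ≤ ∑ i ∈ I, 8 * (p * n) := Finset.sum_le_sum fun i _ => h1 i
          _ = _ := by simp [ha]; ring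
      have e2 : ((Om ∩ (I ×ˢ J)).card : ℝ) ≤ 8 * (p * m) * b := by
        have s1 : Om ∩ (I ×ˢ J) ⊆ J.biUnion (fun i => Om ∩ (Finset.univ ×ˢ {i})) := by
          intro e he
          simp only [Finset.mem_inter, Finset.mem_product] at he
          simp only [Finset.mem_biUnion, Finset.mem_inter, Finset.mem_product, Finset.mem_singleton, Finset.mem_univ, true_and]
          exact ⟨e.2, he.2.2, he.1, rfl⟩
        have s2 := (Finset.card_le_card s1).trans Finset.card_biUnion_le
        calc ((Om ∩ (I ×ˢ J)).card : ℝ) ≤ ∑ i ∈ J, ((Om ∩ (Finset.univ ×ˢ {i})).card : ℝ) := by exact_mod_cast s2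
          _ ≤ ∑ i ∈ J, 8 * (p * m) := Finset.sum_le_sum fun i _ => h2 i
          _ = _ := by simp [hb]; ring
      have e3 : p * m * b = p * n * ab := by rw [hab]; field_simp
      have e4 : 0 < p * (a * b) := by positivity
      rcases min_choice a ab with h | h
      · rw [hA', h]; nlinarith
      · rw [hA', h]; nlinarith
    rw [this]; simp; positivity
  have hx : 100 * A ≤ 64 * (p * n * A') := by
    have s := Real.sq_sqrt (show 0 ≤ p * m * (a * b) by positivity)
    have s0 := Real.sqrt_nonneg (p * m * (a * b))
    have s1 : 100 * (p * m * (a * b)) ≤ 64 * (p * n * A')^2 := by nlinarith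
    rw [hprod] at s1
    have : 0 < p * n * A' := by positivity
    by_contra hcon
    push Not at hcon
    nlinarith
  have hAs : A ≤ Real.sqrt (p * m * (a * b)) := by
    refine Real.le_sqrt_of_sq_le ?_
    rw [hprod]; nlinarith
  set z := p * (a * b) with hz
  have hz0 : 0 < z := by positivity
  have hDc : ((S : ℝ) / (Fintype.card (Fin m × Fin n)) ) * ((I ×ˢ J).card : ℝ) = z := by
    rw [hcard, Finset.card_product]; push_cast; rw [← hp]
  have key := mc_tail S (by rw [hcard]; exact hS) (I ×ˢ J) (8 * z + 10 * Real.sqrt (p * m * (a * b))) (10 * (A * Real.log (Real.exp 1 * m / A)))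
    (by positivity) (by rw [hDc]; exact hz0) (by
      intro k hk
      rw [hDc]
      have s := Real.sq_sqrt (show 0 ≤ p * m * (a * b) by positivity)
      have s0 := Real.sqrt_nonneg (p * m * (a * b))
      refine mc_rate A m z k hA0 hAm hz0 (by linarith) ?_ (by linarith)
      have : 10 * Real.sqrt (p * m * (a * b)) ≤ k := by linarith
      have h2 : m * z = p * m * (a * b) := by rw [hz]; ring
      nlinarith)
  rw [hcard] at key
  have hsub : (Finset.powersetCard S (Finset.univ : Finset (Fin m × Fin n))).filter (fun Om =>
      (∀ i, ((Om ∩ ({i} ×ˢ Finset.univ)).card : ℝ) ≤ 8 * (p * n)) ∧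
      (∀ j, ((Om ∩ (Finset.univ ×ˢ {j})).card : ℝ) ≤ 8 * (p * m)) ∧
      8 * z + 10 * Real.sqrt (p * m * (a * b)) < ((Om ∩ (I ×ˢ J)).card : ℝ)) ⊆ (Finset.powersetCard S (Finset.univ : Finset (Fin m × Fin n))).filter (fun Om =>
      8 * z + 10 * Real.sqrt (p * m * (a * b)) < ((Om ∩ (I ×ˢ J)).card : ℝ)) := by
    intro Om hO
    rw [Finset.mem_filter] at hO ⊢
    exact ⟨hO.1, hO.2.2.2⟩
  refine (Nat.cast_le.2 (Finset.card_le_card hsub)).trans (key.trans ?_)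
  gcongr
  rw [← Real.exp_add]
  gcongr
  have f1 := mc_mono a A m ha0 (le_max_left _ _) hAm
  have f2 := mc_mono ab A m hab0 (le_max_right _ _) hAm
  have f3 : Real.exp 1 * m / ab = Real.exp 1 * n / b := by rw [hab]; field_simp
  rw [f3] at f2
  have f4 : 0 ≤ Real.log (Real.exp 1 * n / b) := by
    refine Real.log_nonneg ?_
    rw [le_div_iff₀ hb0]
    have := Real.add_one_le_exp 1
    nlinarith
  have f5 : b ≤ ab := by
    rw [hab, div_mul_eq_mul_div, le_div_iff₀ hn0]; nlinarith
  have f6 := mul_le_mul_of_nonneg_right f5 f4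
  linarith

lemma mc_E2 (m n S : ℕ) (hn : 1 ≤ n) (hnm : n ≤ m) (hS : S ≤ m * n) (hS0 : 0 < S) (p : ℝ)
    (hp : p = (S:ℝ) / (m * n)) (hpn : 1 + Real.log m ≤ p * n) :
    (((Finset.powersetCard S (Finset.univ : Finset (Fin m × Fin n))).filter (fun Om =>
      ∃ (I : Finset (Fin m)) (J : Finset (Fin n)),
      8 * (p * (I.card * J.card)) + 10 * Real.sqrt (p * m * (I.card * J.card)) < ((Om ∩ (I ×ˢ J)).card : ℝ))).card : ℝ) ≤
      ((m * n).choose S : ℝ) / (n:ℝ)^4 := by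
  have hm0 : (0:ℝ) < m := by exact_mod_cast (show 0 < m by omega)
  have hn0 : (0:ℝ) < n := by exact_mod_cast (show 0 < n by omega)
  have hn1 : (1:ℝ) ≤ n := by exact_mod_cast hn
  have hnm' : (n:ℝ) ≤ m := by exact_mod_cast hnm
  have hp0 : 0 < p := by rw [hp]; positivity
  have hcard : (Fintype.card (Fin m × Fin n)) = m * n := by simp
  set T := Finset.powersetCard S (Finset.univ : Finset (Fin m × Fin n)) with hT
  set c : ℝ := ((m * n).choose S : ℝ) with hc
  have hc0 : 0 ≤ c := by positivity
  let B1 := (Finset.univ : Finset (Fin m)).biUnion fun i => T.filter (fun Om => 8 * (p * n) < ((Om ∩ ({i} ×ˢ Finset.univ)).card : ℝ))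
  let B2 := (Finset.univ : Finset (Fin n)).biUnion fun j => T.filter (fun Om => 8 * (p * m) < ((Om ∩ (Finset.univ ×ˢ {j})).card : ℝ))
  let B3 := (Finset.univ : Finset (Finset (Fin m) × Finset (Fin n))).biUnion fun q => if q.1.card = 0 ∨ q.2.card = 0 then ∅ else T.filter (fun Om =>
      (∀ i, ((Om ∩ ({i} ×ˢ Finset.univ)).card : ℝ) ≤ 8 * (p * n)) ∧
      (∀ j, ((Om ∩ (Finset.univ ×ˢ {j})).card : ℝ) ≤ 8 * (p * m)) ∧
      8 * (p * (q.1.card * q.2.card)) + 10 * Real.sqrt (p * m * (q.1.card * q.2.card)) < ((Om ∩ (q.1 ×ˢ q.2)).card : ℝ))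
  have hsub : T.filter (fun Om =>
      ∃ (I : Finset (Fin m)) (J : Finset (Fin n)),
      8 * (p * (I.card * J.card)) + 10 * Real.sqrt (p * m * (I.card * J.card)) < ((Om ∩ (I ×ˢ J)).card : ℝ)) ⊆ B1 ∪ B2 ∪ B3 := by
    intro Om hO
    obtain ⟨hOT, I, J, hIJ⟩ := Finset.mem_filter.1 hO
    by_cases h1 : ∀ i, ((Om ∩ ({i} ×ˢ Finset.univ)).card : ℝ) ≤ 8 * (p * n)
    swap
    · push Not at h1
      obtain ⟨i, hi⟩ := h1
      refine Finset.mem_union_left _ (Finset.mem_union_left _ (Finset.mem_biUnion.2 ⟨i, Finset.mem_univ _, Finset.mem_filter.2 ⟨hOT, hi⟩⟩))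
    by_cases h2 : ∀ j, ((Om ∩ (Finset.univ ×ˢ {j})).card : ℝ) ≤ 8 * (p * m)
    swap
    · push Not at h2
      obtain ⟨i, hi⟩ := h2
      refine Finset.mem_union_left _ (Finset.mem_union_right _ (Finset.mem_biUnion.2 ⟨i, Finset.mem_univ _, Finset.mem_filter.2 ⟨hOT, hi⟩⟩))
    refine Finset.mem_union_right _ (Finset.mem_biUnion.2 ⟨(I, J), Finset.mem_univ _, ?_⟩)
    rw [if_neg]
    · exact Finset.mem_filter.2 ⟨hOT, h1, h2, hIJ⟩
    · rintro (h | h)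
      · have : I = ∅ := Finset.card_eq_zero.1 h
        subst this
        simp at hIJ
      · have : J = ∅ := Finset.card_eq_zero.1 h
        subst this
        simp at hIJ
  have b1 : (B1.card : ℝ) ≤ m * (Real.exp (-(8 * (p * n))) * c) := by
    have : (B1.card : ℝ) ≤ ∑ i : Fin m, ((T.filter (fun Om => 8 * (p * n) < ((Om ∩ ({i} ×ˢ Finset.univ)).card : ℝ))).card : ℝ) := by
      exact_mod_cast Finset.card_biUnion_le
    refine this.trans ((Finset.sum_le_sum (g := fun _ => Real.exp (-(8 * (p * n))) * c) ?_).trans (by simp))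
    intro i _
    have hD : (S / Fintype.card (Fin m × Fin n) : ℝ) * (({i} ×ˢ Finset.univ : Finset (Fin m × Fin n)).card : ℝ) = p * n := by
      rw [hcard, Finset.card_product]; simp [hp]
    have := mc_tail_simple S (by rw [hcard]; exact hS) ({i} ×ˢ Finset.univ : Finset (Fin m × Fin n)) (by rw [hD]; positivity)
    rw [hD, hcard] at this
    exact this
  have b2 : (B2.card : ℝ) ≤ n * (Real.exp (-(8 * (p * m))) * c) := by
    have : (B2.card : ℝ) ≤ ∑ i : Fin n, ((T.filter (fun Om => 8 * (p * m) < ((Om ∩ (Finset.univ ×ˢ {i})).card : ℝ))).card : ℝ) := by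
      exact_mod_cast Finset.card_biUnion_le
    refine this.trans ((Finset.sum_le_sum (g := fun _ => Real.exp (-(8 * (p * m))) * c) ?_).trans (by simp))
    intro i _
    have hD : (S / Fintype.card (Fin m × Fin n) : ℝ) * ((Finset.univ ×ˢ {i} : Finset (Fin m × Fin n)).card : ℝ) = p * m := by
      rw [hcard, Finset.card_product]; simp [hp]
    have := mc_tail_simple S (by rw [hcard]; exact hS) (Finset.univ ×ˢ {i} : Finset (Fin m × Fin n)) (by rw [hD]; positivity)
    rw [hD, hcard] at this
    exact this
  have b3 : (B3.card : ℝ) ≤ (Real.exp (-4) / (m:ℝ)^3) * (Real.exp (-4) / (n:ℝ)^3) * c := by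
    let f : ∀ k : ℕ, Finset (Fin k) → ℝ := fun k I => if I.card = 0 then (0:ℝ) else Real.exp (-(5 * (I.card * Real.log (Real.exp 1 * k / I.card))))
    have hf0 : ∀ k I, 0 ≤ f k I := by
      intro k I; simp only [f]; split_ifs <;> positivity
    have h1 : (B3.card : ℝ) ≤ ∑ q : Finset (Fin m) × Finset (Fin n), f m q.1 * f n q.2 * c := by
      refine (Nat.cast_le.2 Finset.card_biUnion_le).trans ?_
      push_cast
      refine Finset.sum_le_sum ?_
      rintro ⟨I, J⟩ _
      by_cases h : I.card = 0 ∨ J.card = 0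
      · rw [if_pos h]; simp
        exact mul_nonneg (mul_nonneg (hf0 _ _) (hf0 _ _)) hc0
      · rw [if_neg h]
        push Not at h
        simp only [f]
        rw [if_neg h.1, if_neg h.2]
        exact mc_pair m n S hn hnm hS hS0 p hp I J h.1 h.2
    refine h1.trans ?_
    rw [← Finset.sum_mul, ← Finset.univ_product_univ, Finset.sum_product, ← Finset.sum_mul_sum]
    gcongr
    · exact mc_sumset m (by omega)
    · exact mc_sumset n hn
  have hexp : Real.exp (-4) ≤ 1/4 := by
    rw [Real.exp_neg, inv_le_comm₀ (by positivity) (by norm_num)]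
    have := Real.add_one_le_exp 4; norm_num at this ⊢; linarith
  have hexpn : ∀ x : ℝ, 1 + Real.log m ≤ x → Real.exp (-(8 * x)) ≤ 1/4 / (m:ℝ)^8 := by
    intro x hx
    calc Real.exp (-(8*x)) ≤ Real.exp (-4 + -(8 * Real.log m)) := by gcongr; linarith
      _ = Real.exp (-4) / (m:ℝ)^8 := by
        rw [Real.exp_add, Real.exp_neg (8 * Real.log m), div_eq_mul_inv]
        congr 2
        rw [show (8:ℝ) = ((8:ℕ):ℝ) by norm_num, Real.exp_nat_mul, Real.exp_log hm0]
      _ ≤ _ := by gcongr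
  have c1 : m * (Real.exp (-(8 * (p * n))) * c) ≤ (1/4) * (c / n^4) := by
    calc m * (Real.exp (-(8 * (p * n))) * c) ≤ m * (1/4/(m:ℝ)^8 * c) := by gcongr; exact hexpn _ hpn
      _ = (1/4) * (c/(m:ℝ)^7) := by field_simp
      _ ≤ (1/4) * (c/(n:ℝ)^7) := by gcongr
      _ ≤ _ := by gcongr; norm_num
  have c2 : n * (Real.exp (-(8 * (p * m))) * c) ≤ (1/4) * (c / n^4) := by
    have : p * n ≤ p * m := by gcongr
    calc n * (Real.exp (-(8 * (p * m))) * c) ≤ n * (1/4/(m:ℝ)^8 * c) := by gcongr; exact hexpn _ (by linarith)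
      _ ≤ n * (1/4/(n:ℝ)^8 * c) := by gcongr
      _ = (1/4) * (c/(n:ℝ)^7) := by field_simp
      _ ≤ _ := by gcongr; norm_num
  have c3 : (Real.exp (-4) / (m:ℝ)^3) * (Real.exp (-4) / (n:ℝ)^3) * c ≤ (1/4) * (c / n^4) := by
    calc (Real.exp (-4) / (m:ℝ)^3) * (Real.exp (-4) / (n:ℝ)^3) * c ≤ (1/4 / (n:ℝ)^3) * (1 / (n:ℝ)^3) * c := by gcongr; linarith
      _ = (1/4) * (c/(n:ℝ)^6) := by field_simp
      _ ≤ _ := by gcongr; norm_num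
  have hfin : ((B1 ∪ B2 ∪ B3).card : ℝ) ≤ B1.card + B2.card + B3.card := by
    have h1 := Finset.card_union_le (B1 ∪ B2) B3
    have h2 := Finset.card_union_le B1 B2
    exact_mod_cast (by omega : (B1 ∪ B2 ∪ B3).card ≤ B1.card + B2.card + B3.card)
  refine (Nat.cast_le.2 (Finset.card_le_card hsub)).trans (hfin.trans ?_)
  have : 0 ≤ c / (n:ℝ)^4 := by positivity
  linarith

lemma mc_bil1 {ι : Type*} [Fintype ι] (c s : ι → ℝ) (P Q M1 : ℝ) (hQ : 0 ≤ Q)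
    (h : ∀ I : Finset ι, ∑ i ∈ I, c i ≤ P * I.card + Q * Real.sqrt I.card)
    (hs0 : ∀ i, 0 ≤ s i) (hs : ∀ i, s i ≤ M1) :
    ∑ i, c i * s i ≤ P * ∑ i, s i + Q * Real.sqrt (M1 * ∑ i, s i) := by
  by_cases hT : ∑ i, s i = 0
  · have h0 : ∀ i, s i = 0 := fun i => (Finset.sum_eq_zero_iff_of_nonneg (fun i _ => hs0 i)).1 hT i (Finset.mem_univ _)
    simp [h0]
  have hT0 : 0 < ∑ i, s i := lt_of_le_of_ne (Finset.sum_nonneg fun i _ => hs0 i) (Ne.symm hT)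
  set T := ∑ i, s i with hTd
  have hM1 : 0 < M1 := by
    obtain ⟨i, _, hi⟩ := Finset.exists_ne_zero_of_sum_ne_zero hT
    exact lt_of_lt_of_le (lt_of_le_of_ne (hs0 i) (Ne.symm hi)) (hs i)
  set g := Real.sqrt (M1 * T) with hg
  have hg0 : 0 < g := Real.sqrt_pos.2 (by positivity)
  have hgg : g * g = M1 * T := Real.mul_self_sqrt (by positivity)
  set P' := P + Q * (g / T) / 2 with hP'
  have h1 : ∀ I : Finset ι, M1 * ∑ i ∈ I, (c i - P') ≤ Q * g / 2 := by
    intro I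
    rw [Finset.sum_sub_distrib]
    simp only [Finset.sum_const, nsmul_eq_mul]
    have hI := h I
    set z := Real.sqrt (I.card : ℝ) with hz
    have hzz : z * z = I.card := Real.mul_self_sqrt (by positivity)
    have : M1 * (Q * z - Q * (g/T)/2 * (z*z)) ≤ Q * g / 2 := by
      have e : M1 * (Q * z - Q * (g/T)/2 * (z*z)) = Q * (M1 * z - M1 * (g/T)/2*(z*z)) := by ring
      rw [e, mul_div_assoc Q g 2]
      apply mul_le_mul_of_nonneg_left _ hQ
      have e2 : M1 = g * g / T := by rw [hgg]; field_simp
      rw [e2]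
      have : g / 2 - (g * g / T * z - g * g / T * (g / T) / 2 * (z * z)) = g / 2 * (1 - g * z / T)^2 := by
        field_simp; ring
      have h3 : 0 ≤ g / 2 * (1 - g * z / T)^2 := by positivity
      linarith
    rw [← hzz] at hI ⊢
    have h4 : M1 * (∑ i ∈ I, c i) ≤ M1 * (P * (z*z) + Q * z) := by gcongr
    rw [hP']
    nlinarith
  have h2 : ∑ i, (c i - P') * s i ≤ M1 * ∑ i ∈ Finset.univ.filter (fun i => 0 < c i - P'), (c i - P') := by
    rw [Finset.mul_sum, Finset.sum_filter]
    refine Finset.sum_le_sum ?_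
    intro i _
    split_ifs with hi
    · have := hs i; nlinarith
    · have := hs0 i; nlinarith
  have h3 := h1 (Finset.univ.filter (fun i => 0 < c i - P'))
  have h4 : ∑ i, (c i - P') * s i = ∑ i, c i * s i - P' * T := by
    rw [hTd, Finset.mul_sum, ← Finset.sum_sub_distrib]
    exact Finset.sum_congr rfl fun i _ => by ring
  have h5 : P' * T = P * T + Q * g / 2 := by rw [hP']; field_simp
  linarith

lemma mc_bil2 {m n : ℕ} (Om : Finset (Fin m × Fin n)) (p : ℝ) (hp : 0 ≤ p)
    (h : ∀ (I : Finset (Fin m)) (J : Finset (Fin n)), ((Om ∩ (I ×ˢ J)).card : ℝ) ≤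
      8 * (p * (I.card * J.card)) + 10 * Real.sqrt (p * m * (I.card * J.card)))
    (s : Fin m → ℝ) (t : Fin n → ℝ) (M1 M2 : ℝ) (hs0 : ∀ i, 0 ≤ s i) (hs : ∀ i, s i ≤ M1)
    (ht0 : ∀ i, 0 ≤ t i) (ht : ∀ i, t i ≤ M2) :
    ∑ e ∈ Om, s e.1 * t e.2 ≤ 8 * p * (∑ i, s i) * (∑ j, t j) +
      10 * Real.sqrt (p * m) * Real.sqrt (M1 * ∑ i, s i) * Real.sqrt (M2 * ∑ j, t j) := by
  let w : Fin m → Fin n → ℝ := fun i j => if (i, j) ∈ Om then 1 else 0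
  have hw : ∀ (I : Finset (Fin m)) (J : Finset (Fin n)), ∑ i ∈ I, ∑ j ∈ J, w i j = ((Om ∩ (I ×ˢ J)).card : ℝ) := by
    intro I J
    rw [← Finset.sum_product', Finset.inter_comm, Finset.card_eq_sum_ones, Nat.cast_sum, ← Finset.filter_mem_eq_inter, Finset.sum_filter]
    refine Finset.sum_congr rfl ?_
    rintro ⟨i, j⟩ _
    simp [w]
  have hsum : ∑ e ∈ Om, s e.1 * t e.2 = ∑ j, (∑ i, w i j * s i) * t j := by
    have : ∑ j, (∑ i, w i j * s i) * t j = ∑ i, ∑ j, w i j * (s i * t j) := by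
      rw [Finset.sum_comm]
      refine Finset.sum_congr rfl fun j _ => ?_
      rw [Finset.sum_mul]
      exact Finset.sum_congr rfl fun i _ => by ring
    rw [this, ← Finset.sum_product']
    rw [Finset.univ_product_univ, ← Finset.sum_subset (Finset.subset_univ Om)]
    · refine Finset.sum_congr rfl ?_
      rintro ⟨i, j⟩ he
      simp [w, he]
    · rintro ⟨i, j⟩ _ he
      simp [w, he]
  rw [hsum]
  have hS0 : 0 ≤ ∑ i, s i := Finset.sum_nonneg fun i _ => hs0 i
  refine mc_bil1 (fun j => ∑ i, w i j * s i) t (8 * p * ∑ i, s i) (10 * Real.sqrt (p * m) * Real.sqrt (M1 * ∑ i, s i)) M2 (by positivity) ?_ ht0 ht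
  intro J
  have h1 : ∑ j ∈ J, ∑ i, w i j * s i = ∑ i, (∑ j ∈ J, w i j) * s i := by
    rw [Finset.sum_comm]
    exact Finset.sum_congr rfl fun i _ => by rw [Finset.sum_mul]
  rw [h1]
  refine (mc_bil1 (fun i => ∑ j ∈ J, w i j) s (8 * p * J.card) (10 * Real.sqrt (p * m) * Real.sqrt J.card) M1 (by positivity) ?_ hs0 hs).trans (le_of_eq (by ring))
  intro I
  rw [hw]
  refine (h I J).trans (le_of_eq ?_)
  rw [Real.sqrt_mul (by positivity : 0 ≤ p * (m:ℝ)), Real.sqrt_mul (by positivity : (0:ℝ) ≤ I.card)]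
  ring

lemma frob_nonneg' {m n : ℕ} (A : Matrix (Fin m) (Fin n) ℝ) : 0 ≤ frob A := Real.sqrt_nonneg _
lemma frob_sq {m n : ℕ} (A : Matrix (Fin m) (Fin n) ℝ) : frob A ^ 2 = ∑ i, ∑ j, A i j ^ 2 :=
  Real.sq_sqrt (Finset.sum_nonneg fun _ _ => Finset.sum_nonneg fun _ _ => sq_nonneg _)
lemma rowNorm_nonneg' {m n : ℕ} (A : Matrix (Fin m) (Fin n) ℝ) (i : Fin m) : 0 ≤ rowNorm A i := Real.sqrt_nonneg _
lemma rowNorm_sq {m n : ℕ} (A : Matrix (Fin m) (Fin n) ℝ) (i : Fin m) : rowNorm A i ^ 2 = ∑ j, A i j ^ 2 :=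
  Real.sq_sqrt (Finset.sum_nonneg fun _ _ => sq_nonneg _)
lemma frob_sq_rows {m n : ℕ} (A : Matrix (Fin m) (Fin n) ℝ) : frob A ^ 2 = ∑ i, rowNorm A i ^ 2 := by
  rw [frob_sq]; exact Finset.sum_congr rfl fun i _ => (rowNorm_sq A i).symm
lemma finner_self {m n : ℕ} (A : Matrix (Fin m) (Fin n) ℝ) : finner A A = frob A ^ 2 := by
  rw [frob_sq, finner]; simp [pow_two]
lemma finner_comm' {m n : ℕ} (A B : Matrix (Fin m) (Fin n) ℝ) : finner A B = finner B A := by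
  simp [finner, mul_comm]
lemma finner_add_left {m n : ℕ} (A B C : Matrix (Fin m) (Fin n) ℝ) : finner (A + B) C = finner A C + finner B C := by
  simp [finner, add_mul, Finset.sum_add_distrib]
lemma finner_smul_left {m n : ℕ} (c : ℝ) (A C : Matrix (Fin m) (Fin n) ℝ) : finner (c • A) C = c * finner A C := by
  simp [finner, mul_assoc, Finset.mul_sum]
lemma finner_add_right {m n : ℕ} (A B C : Matrix (Fin m) (Fin n) ℝ) : finner C (A + B) = finner C A + finner C B := by
  simp [finner, mul_add, Finset.sum_add_distrib]
lemma finner_sub_right {m n : ℕ} (A B C : Matrix (Fin m) (Fin n) ℝ) : finner C (A - B) = finner C A - finner C B := by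
  simp [finner, mul_sub, Finset.sum_sub_distrib]
lemma finner_sub_left {m n : ℕ} (A B C : Matrix (Fin m) (Fin n) ℝ) : finner (A - B) C = finner A C - finner B C := by
  simp [finner, sub_mul, Finset.sum_sub_distrib]
lemma finner_tr {m n : ℕ} (A B : Matrix (Fin m) (Fin n) ℝ) : finner A B = (Aᵀ * B).trace := by
  simp only [finner, Matrix.trace, Matrix.diag, Matrix.mul_apply, Matrix.transpose_apply]
  rw [Finset.sum_comm]
lemma finner_transpose {m n : ℕ} (A B : Matrix (Fin m) (Fin n) ℝ) : finner Aᵀ Bᵀ = finner A B := by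
  simp only [finner, Matrix.transpose_apply]; rw [Finset.sum_comm]
lemma finner_mul_left {m n k : ℕ} (A : Matrix (Fin m) (Fin n) ℝ) (B : Matrix (Fin n) (Fin k) ℝ) (C : Matrix (Fin m) (Fin k) ℝ) :
    finner (A * B) C = finner A (C * Bᵀ) := by
  rw [finner_tr, finner_tr, Matrix.transpose_mul, ← Matrix.mul_assoc, Matrix.mul_assoc Bᵀ, Matrix.trace_mul_comm]
lemma finner_mul_right {m n k : ℕ} (A : Matrix (Fin m) (Fin n) ℝ) (B : Matrix (Fin n) (Fin k) ℝ) (C : Matrix (Fin m) (Fin k) ℝ) :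
    finner (A * B) C = finner B (Aᵀ * C) := by
  rw [finner_tr, finner_tr, Matrix.transpose_mul, Matrix.mul_assoc]
lemma frob_transpose {m n : ℕ} (A : Matrix (Fin m) (Fin n) ℝ) : frob Aᵀ = frob A := by
  simp only [frob, Matrix.transpose_apply]; rw [Finset.sum_comm]
lemma frob_neg' {m n : ℕ} (A : Matrix (Fin m) (Fin n) ℝ) : frob (-A) = frob A := by
  simp [frob]
lemma finner_le {m n : ℕ} (A B : Matrix (Fin m) (Fin n) ℝ) : finner A B ≤ frob A * frob B := by
  have := Real.sum_mul_le_sqrt_mul_sqrt (Finset.univ : Finset (Fin m × Fin n)) (fun e => A e.1 e.2) (fun e => B e.1 e.2)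
  simp only [Fintype.sum_prod_type] at this
  exact this
lemma sq_le_of_nonneg {x y : ℝ} (hy : 0 ≤ y) (h : x ^ 2 ≤ y ^ 2) : x ≤ y := by
  by_contra hc
  push Not at hc
  nlinarith
lemma frob_add_le {m n : ℕ} (A B : Matrix (Fin m) (Fin n) ℝ) : frob (A + B) ≤ frob A + frob B := by
  apply sq_le_of_nonneg (add_nonneg (frob_nonneg' _) (frob_nonneg' _))
  rw [← finner_self, finner_add_left, finner_add_right, finner_add_right, finner_self, finner_self, finner_comm' B A]
  have := finner_le A B
  nlinarith
lemma frob_sub_le {m n : ℕ} (A B : Matrix (Fin m) (Fin n) ℝ) : frob (A - B) ≤ frob A + frob B := by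
  rw [sub_eq_add_neg, ← frob_neg' B]; exact frob_add_le _ _
lemma rowNorm_mul_le {m n k : ℕ} (A : Matrix (Fin m) (Fin n) ℝ) (B : Matrix (Fin n) (Fin k) ℝ) (i : Fin m) :
    rowNorm (A * B) i ≤ rowNorm A i * frob B := by
  apply sq_le_of_nonneg (mul_nonneg (rowNorm_nonneg' _ _) (frob_nonneg' _))
  rw [mul_pow, rowNorm_sq, rowNorm_sq, frob_sq]
  calc ∑ j, (A * B) i j ^ 2 ≤ ∑ j, (∑ l, A i l ^ 2) * (∑ l, B l j ^ 2) := by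
        refine Finset.sum_le_sum fun j _ => ?_
        rw [Matrix.mul_apply]
        exact Finset.sum_mul_sq_le_sq_mul_sq _ _ _
    _ = _ := by rw [← Finset.mul_sum, Finset.sum_comm]
lemma frob_mul_le {m n k : ℕ} (A : Matrix (Fin m) (Fin n) ℝ) (B : Matrix (Fin n) (Fin k) ℝ) :
    frob (A * B) ≤ frob A * frob B := by
  apply sq_le_of_nonneg (mul_nonneg (frob_nonneg' _) (frob_nonneg' _))
  rw [mul_pow, frob_sq_rows (A * B), frob_sq_rows A, Finset.sum_mul]
  refine Finset.sum_le_sum fun i _ => ?_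
  rw [← mul_pow]
  exact pow_le_pow_left₀ (rowNorm_nonneg' _ _) (rowNorm_mul_le A B i) 2
lemma frob_orth {m r k : ℕ} (W : Matrix (Fin m) (Fin r) ℝ) (hW : Wᵀ * W = 1) (B : Matrix (Fin r) (Fin k) ℝ) :
    frob (W * B) = frob B := by
  have : frob (W * B) ^ 2 = frob B ^ 2 := by
    rw [← finner_self, ← finner_self, finner_mul_right, ← Matrix.mul_assoc, hW, Matrix.one_mul]
  exact (pow_left_inj₀ (frob_nonneg' _) (frob_nonneg' _) two_ne_zero).1 this
/-- contraction -/
lemma frob_orth_t {m r k : ℕ} (W : Matrix (Fin m) (Fin r) ℝ) (hW : Wᵀ * W = 1) (B : Matrix (Fin m) (Fin k) ℝ) :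
    frob (Wᵀ * B) ≤ frob B := by
  have h1 : frob (Wᵀ * B) ^ 2 ≤ frob B * frob (Wᵀ * B) := by
    rw [← finner_self, finner_mul_right, Matrix.transpose_transpose]
    refine (finner_le _ _).trans ?_
    rw [frob_orth W hW]
  have := frob_nonneg' (Wᵀ * B)
  have := frob_nonneg' B
  by_contra hc; push Not at hc
  nlinarith
lemma frob_proj {m r k : ℕ} (W : Matrix (Fin m) (Fin r) ℝ) (hW : Wᵀ * W = 1) (B : Matrix (Fin m) (Fin k) ℝ) :
    frob ((1 - W * Wᵀ) * B) ≤ frob B := by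
  apply sq_le_of_nonneg (frob_nonneg' _)
  have h2 : finner (W * Wᵀ * B) (W * Wᵀ * B) = finner (W * Wᵀ * B) B := by
    rw [Matrix.mul_assoc, finner_mul_right W, finner_mul_right W, ← Matrix.mul_assoc, hW, Matrix.one_mul]
  rw [Matrix.sub_mul, Matrix.one_mul, ← finner_self, finner_sub_left, finner_sub_right, finner_sub_right, h2,
    finner_comm' B (W * Wᵀ * B), ← h2, finner_self, finner_self]
  nlinarith [sq_nonneg (frob (W * Wᵀ * B))]
lemma frob_eq_zero {m n : ℕ} (A : Matrix (Fin m) (Fin n) ℝ) (h : frob A = 0) : A = 0 := by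
  have h1 := frob_sq A
  rw [h] at h1
  have h2 : ∑ i, ∑ j, A i j ^ 2 = 0 := by rw [← h1]; ring
  ext i j
  have h3 := (Finset.sum_eq_zero_iff_of_nonneg (fun i _ => Finset.sum_nonneg fun _ _ => sq_nonneg _)).1 h2 i (Finset.mem_univ _)
  have h4 := (Finset.sum_eq_zero_iff_of_nonneg (fun i _ => sq_nonneg _)).1 h3 j (Finset.mem_univ _)
  simpa using h4
lemma frob_diag_le {r k : ℕ} (σ : Fin r → ℝ) (s : ℝ) (hs : 0 ≤ s) (h : ∀ i, s ≤ σ i) (Z : Matrix (Fin r) (Fin k) ℝ) :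
    s * frob Z ≤ frob (Matrix.diagonal σ * Z) := by
  apply sq_le_of_nonneg (frob_nonneg' _)
  rw [mul_pow, frob_sq, frob_sq, Finset.mul_sum]
  refine Finset.sum_le_sum fun i _ => ?_
  rw [Finset.mul_sum]
  refine Finset.sum_le_sum fun j _ => ?_
  rw [Matrix.diagonal_mul, mul_pow]
  have := h i
  gcongr

lemma mc_factor {m n r : ℕ} (Uh : Matrix (Fin m) (Fin r) ℝ) (Vh : Matrix (Fin n) (Fin r) ℝ)
    (σ : Fin r → ℝ) (Smin : ℝ) (hU : Uhᵀ * Uh = 1) (hV : Vhᵀ * Vh = 1) (hS : 0 < Smin)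
    (hσ : ∀ k, Smin ≤ σ k) (M : Matrix (Fin m) (Fin n) ℝ) (hM : M = Uh * Matrix.diagonal σ * Vhᵀ)
    (X : Matrix (Fin m) (Fin r) ℝ) (Y : Matrix (Fin n) (Fin r) ℝ) (βT : ℝ)
    (hX : frob X ≤ βT) (hY : frob Y ≤ βT) (hd : frob (X * Yᵀ - M) ≤ Smin / 2) :
    ∃ (A B : Matrix (Fin r) (Fin r) ℝ), (Uh * A) * (Vh * B)ᵀ = M ∧ frob A ≤ βT ∧
      frob (X - Uh * A) ≤ 2 * βT / Smin * frob (X * Yᵀ - M) ∧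
      frob (Y - Vh * B) ≤ 2 * βT / Smin * frob (X * Yᵀ - M) ∧
      0 ≤ finner X (X - Uh * A) := by
  set E := X * Yᵀ - M with hE
  set d := frob E with hdd
  have hβ : 0 ≤ βT := (frob_nonneg' X).trans hX
  set A := Uhᵀ * X with hA
  have hAβ : frob A ≤ βT := (frob_orth_t Uh hU X).trans hX
  have hXY : X * Yᵀ = E + M := by rw [hE]; abel
  have hYA : Y * Aᵀ = Eᵀ * Uh + Vh * Matrix.diagonal σ := by
    have : Y * Aᵀ = (X * Yᵀ)ᵀ * Uh := by
      rw [hA]; simp [Matrix.transpose_mul, Matrix.mul_assoc]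
    rw [this, hXY, hM]
    simp only [Matrix.transpose_add, Matrix.transpose_mul, Matrix.add_mul, Matrix.transpose_transpose, Matrix.diagonal_transpose, Matrix.mul_assoc, hU, Matrix.mul_one]
  have key : ∀ (k : ℕ) (Z : Matrix (Fin r) (Fin k) ℝ), Smin / 2 * frob Z ≤ frob (Y * (Aᵀ * Z)) := by
    intro k Z
    have e1 : Vh * (Matrix.diagonal σ * Z) = Y * (Aᵀ * Z) - Eᵀ * (Uh * Z) := by
      rw [← Matrix.mul_assoc Y, hYA]; simp [Matrix.add_mul, Matrix.mul_assoc]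
    have e2 := frob_diag_le σ Smin hS.le hσ Z
    rw [← frob_orth Vh hV (Matrix.diagonal σ * Z), e1] at e2
    have e3 := frob_sub_le (Y * (Aᵀ * Z)) (Eᵀ * (Uh * Z))
    have e4 := frob_mul_le Eᵀ (Uh * Z)
    rw [frob_transpose, frob_orth Uh hU] at e4
    have e5 := frob_nonneg' Z
    nlinarith
  have key2 : ∀ (k : ℕ) (Z : Matrix (Fin r) (Fin k) ℝ), Smin / 2 * frob Z ≤ βT * frob (Aᵀ * Z) := by
    intro k Z
    refine (key k Z).trans ((frob_mul_le _ _).trans ?_)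
    gcongr
    exact frob_nonneg' _
  have hdet : (Aᵀ).det ≠ 0 := by
    intro h0
    obtain ⟨v, hv0, hv⟩ := Matrix.exists_mulVec_eq_zero_iff.2 h0
    let Z : Matrix (Fin r) (Fin 1) ℝ := Matrix.of fun i _ => v i
    have hZ : Aᵀ * Z = 0 := by
      ext i j
      have := congrFun hv i
      simpa [Matrix.mul_apply, Matrix.mulVec, dotProduct, Z] using this
    have h1 := key2 1 Z
    rw [hZ] at h1
    have h2 : frob (0 : Matrix (Fin r) (Fin 1) ℝ) = 0 := by simp [frob]
    rw [h2, mul_zero] at h1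
    have h3 : frob Z = 0 := le_antisymm (by
      by_contra hc
      push Not at hc
      have : 0 < Smin / 2 * frob Z := by positivity
      linarith) (frob_nonneg' _)
    apply hv0
    ext i
    have := congrFun (congrFun (frob_eq_zero Z h3) i) 0
    simpa [Z] using this
  have hunit : IsUnit (Aᵀ).det := isUnit_iff_ne_zero.2 hdet
  set B := (Aᵀ)⁻¹ with hB
  have hAB : Aᵀ * B = 1 := Matrix.mul_nonsing_inv _ hunit
  have hBA : B * Aᵀ = 1 := Matrix.nonsing_inv_mul _ hunit
  have hAB' : A * Bᵀ = 1 := by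
    have := congrArg Matrix.transpose hBA
    simpa [Matrix.transpose_mul] using this
  have hPM : (1 - Uh * Uhᵀ) * M = 0 := by
    rw [hM, Matrix.sub_mul, Matrix.one_mul]
    simp only [Matrix.mul_assoc]
    rw [← Matrix.mul_assoc Uhᵀ Uh, hU, Matrix.one_mul, sub_self]
  have hXU : X - Uh * A = (1 - Uh * Uhᵀ) * X := by
    rw [hA, Matrix.sub_mul, Matrix.one_mul, Matrix.mul_assoc]
  refine ⟨A, Matrix.diagonal σ * B, ?_, hAβ, ?_, ?_, ?_⟩
  · rw [hM]
    simp only [Matrix.transpose_mul, Matrix.diagonal_transpose, Matrix.mul_assoc]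
    rw [← Matrix.mul_assoc A, hAB', Matrix.one_mul]
  · -- X
    have h1 : (X - Uh * A) * Yᵀ = (1 - Uh * Uhᵀ) * E := by
      rw [hXU, Matrix.mul_assoc, hXY, Matrix.mul_add, hPM, add_zero]
    have h2 := frob_proj Uh hU E
    rw [← h1] at h2
    set Z' := (X - Uh * A)ᵀ with hZ'
    have h3 := key _ (B * Z')
    rw [← Matrix.mul_assoc Aᵀ, hAB, Matrix.one_mul] at h3
    have h4 : frob (Y * Z') ≤ d := by
      rw [← frob_transpose, Matrix.transpose_mul, hZ', Matrix.transpose_transpose]; exact h2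
    have h5 : frob Z' ≤ βT * frob (B * Z') := by
      have : Z' = Aᵀ * (B * Z') := by rw [← Matrix.mul_assoc, hAB, Matrix.one_mul]
      calc frob Z' = frob (Aᵀ * (B * Z')) := by rw [← this]
        _ ≤ frob Aᵀ * frob (B * Z') := frob_mul_le _ _
        _ ≤ _ := by rw [frob_transpose]; gcongr; exact frob_nonneg' _
    rw [← frob_transpose, ← hZ']
    have h6 : frob (B * Z') ≤ 2 / Smin * d := by
      rw [div_mul_eq_mul_div, le_div_iff₀ hS]; linarith
    calc frob Z' ≤ βT * (2 / Smin * d) := h5.trans (by gcongr)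
      _ = _ := by ring
  · have h1 : Y - Vh * (Matrix.diagonal σ * B) = (Eᵀ * Uh) * B := by
      have : Y = (Y * Aᵀ) * B := by rw [Matrix.mul_assoc, hAB, Matrix.mul_one]
      have h2 : Y - Vh * (Matrix.diagonal σ * B) = (Y * Aᵀ) * B - Vh * (Matrix.diagonal σ * B) := by rw [← this]
      rw [h2, hYA, Matrix.add_mul, ← Matrix.mul_assoc Vh]; abel
    rw [h1]
    set N := Eᵀ * Uh with hN
    have hNd : frob N ≤ d := by
      rw [hN, ← frob_transpose, Matrix.transpose_mul, Matrix.transpose_transpose]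
      exact frob_orth_t Uh hU E
    set D := N * B with hD
    have h2 : frob D ^ 2 ≤ frob N * frob (B * Dᵀ) := by
      rw [← finner_self]
      nth_rewrite 1 [hD]
      rw [finner_mul_left, ← frob_transpose (B * Dᵀ), Matrix.transpose_mul, Matrix.transpose_transpose]
      exact finner_le _ _
    have h3 := key2 _ (B * Dᵀ)
    rw [← Matrix.mul_assoc, hAB, Matrix.one_mul, frob_transpose] at h3
    have h4 : frob (B * Dᵀ) ≤ 2 * βT / Smin * frob D := by
      rw [div_mul_eq_mul_div, le_div_iff₀ hS]; linarith
    have h5 := frob_nonneg' D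
    have h6 := frob_nonneg' N
    have hc : 0 ≤ 2 * βT / Smin := by positivity
    have h7 : frob D ^ 2 ≤ d * (2 * βT / Smin * frob D) := h2.trans (mul_le_mul hNd h4 (frob_nonneg' _) (frob_nonneg' E))
    by_contra hcon
    push Not at hcon
    have h8 : 0 < frob D := lt_of_le_of_lt (by have := frob_nonneg' E; positivity) hcon
    nlinarith
  · have h1 : finner (Uh * A) (X - Uh * A) = 0 := by
      rw [finner_mul_right, Matrix.mul_sub, ← Matrix.mul_assoc Uhᵀ Uh, hU, Matrix.one_mul, ← hA, sub_self]
      simp [finner]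
    have h2 : finner (X - Uh * A) (X - Uh * A) = finner X (X - Uh * A) := by
      rw [finner_sub_left, h1, sub_zero]
    rw [← h2, finner_self]
    positivity

/-- main term -/
lemma mc_main {m n r : ℕ} (Uh : Matrix (Fin m) (Fin r) ℝ) (Vh : Matrix (Fin n) (Fin r) ℝ)
    (hU : Uhᵀ * Uh = 1) (hV : Vhᵀ * Vh = 1) (M : Matrix (Fin m) (Fin n) ℝ)
    (X U : Matrix (Fin m) (Fin r) ℝ) (Y V : Matrix (Fin n) (Fin r) ℝ)
    (A B : Matrix (Fin r) (Fin r) ℝ) (hUA : U = Uh * A) (hVB : V = Vh * B) (hUV : U * Vᵀ = M)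
    (Om : Finset (Fin m × Fin n)) (p bb : ℝ) (hp : 0 ≤ p)
    (hE1 : ∀ Z : Matrix (Fin m) (Fin n) ℝ, (1 - Uh * Uhᵀ) * Z * (1 - Vh * Vhᵀ) = 0 →
      p / 16 * ∑ i, ∑ j, Z i j ^ 2 ≤ ∑ e ∈ Om, Z e.1 e.2 ^ 2)
    (hb : frob (X - U) * frob (Y - V) ≤ frob (X * Yᵀ - M) / 2)
    (hbb : ∑ e ∈ Om, rowNorm (X - U) e.1 ^ 2 * rowNorm (Y - V) e.2 ^ 2 ≤ bb) :
    p / 128 * frob (X * Yᵀ - M) ^ 2 - 5 / 2 * bb ≤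
      finner (projOmega Om (X * Yᵀ - M) * Y) (X - U) + finner ((projOmega Om (X * Yᵀ - M))ᵀ * X) (Y - V) := by
  set E := X * Yᵀ - M with hE
  set a := U * (Y - V)ᵀ + (X - U) * Vᵀ with ha
  set b := (X - U) * (Y - V)ᵀ with hbd
  have hEab : E = a + b := by
    rw [hE, ha, hbd, ← hUV]
    simp only [Matrix.transpose_sub, Matrix.mul_sub, Matrix.sub_mul]
    abel
  have h2 : (X - U) * Yᵀ + X * (Y - V)ᵀ = a + 2 • b := by
    rw [ha, hbd]
    simp only [Matrix.transpose_sub, Matrix.mul_sub, Matrix.sub_mul, two_smul]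
    abel
  have h3 : finner (projOmega Om E * Y) (X - U) + finner ((projOmega Om E)ᵀ * X) (Y - V) = finner (projOmega Om E) (a + 2 • b) := by
    rw [← h2, finner_add_right, finner_mul_left, ← finner_transpose (projOmega Om E) (X * (Y - V)ᵀ), finner_mul_left ((projOmega Om E)ᵀ), Matrix.transpose_mul, Matrix.transpose_transpose]
  have h4 : finner (projOmega Om E) (a + 2 • b) = ∑ e ∈ Om, (a e.1 e.2 + b e.1 e.2) * (a e.1 e.2 + 2 * b e.1 e.2) := by
    rw [hEab, finner, ← Finset.sum_product', Finset.univ_product_univ, ← Finset.sum_subset (Finset.subset_univ Om)]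
    · refine Finset.sum_congr rfl ?_
      rintro ⟨i, j⟩ he
      simp [projOmega, he]
    · rintro ⟨i, j⟩ _ he
      simp [projOmega, he]
  have hT : (1 - Uh * Uhᵀ) * a * (1 - Vh * Vhᵀ) = 0 := by
    have e1 : (1 - Uh * Uhᵀ) * U = 0 := by
      rw [hUA, Matrix.sub_mul, Matrix.one_mul, Matrix.mul_assoc, ← Matrix.mul_assoc Uhᵀ, hU, Matrix.one_mul, sub_self]
    have e2 : Vᵀ * (1 - Vh * Vhᵀ) = 0 := by
      rw [hVB, Matrix.transpose_mul, Matrix.mul_sub, Matrix.mul_one, Matrix.mul_assoc, ← Matrix.mul_assoc Vhᵀ, hV, Matrix.one_mul, sub_self]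
    rw [ha, Matrix.mul_add, Matrix.add_mul, ← Matrix.mul_assoc (1 - Uh * Uhᵀ) U, e1, ← Matrix.mul_assoc (1 - Uh * Uhᵀ) (X - U), Matrix.mul_assoc _ Vᵀ, e2]
    simp
  have h5 := hE1 a hT
  rw [← frob_sq] at h5
  have h6 : ∑ e ∈ Om, (1/2 * a e.1 e.2 ^ 2 - 5/2 * b e.1 e.2 ^2) ≤ ∑ e ∈ Om, (a e.1 e.2 + b e.1 e.2) * (a e.1 e.2 + 2 * b e.1 e.2) := by
    refine Finset.sum_le_sum fun e _ => ?_
    nlinarith [sq_nonneg (a e.1 e.2 + 3 * b e.1 e.2)]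
  rw [Finset.sum_sub_distrib, ← Finset.mul_sum, ← Finset.mul_sum] at h6
  have h7 : ∑ e ∈ Om, b e.1 e.2 ^ 2 ≤ bb := by
    refine (Finset.sum_le_sum fun e _ => ?_).trans hbb
    rw [hbd, Matrix.mul_apply, rowNorm_sq, rowNorm_sq]
    exact Finset.sum_mul_sq_le_sq_mul_sq _ _ _
  have h8 : frob b ≤ frob E / 2 := by
    refine le_trans ?_ hb
    rw [← frob_transpose (Y - V)]
    exact frob_mul_le _ _
  have h9 : frob E / 2 ≤ frob a := by
    have := frob_add_le a b
    rw [← hEab] at this; linarith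
  have h10 : frob E ^ 2 / 4 ≤ frob a ^ 2 := by
    have := frob_nonneg' E
    nlinarith
  have h11 : p / 16 * (frob E ^ 2 / 4) ≤ p / 16 * frob a ^ 2 := by gcongr
  rw [h3, h4]
  linarith

lemma gradG1_eq {m r : ℕ} (ρ β βT : ℝ) (X : Matrix (Fin m) (Fin r) ℝ) :
    gradG1 ρ β βT X = Matrix.diagonal (fun i => ρ * G0' (3 * rowNorm X i ^ 2 / (2 * β ^ 2)) * (3 / β ^ 2)) * X +
      (ρ * G0' (3 * frob X ^ 2 / (2 * βT ^ 2)) * (3 / βT ^ 2)) • X := by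
  rw [gradG1]
  congr 1
  ext i k
  rw [Matrix.diagonal_mul, Matrix.sum_apply]
  simp [rowMat]

lemma finner_diag {m r : ℕ} (c : Fin m → ℝ) (X W : Matrix (Fin m) (Fin r) ℝ) :
    finner (Matrix.diagonal c * X) W = ∑ i, c i * ∑ k, X i k * W i k := by
  simp only [finner, Matrix.diagonal_mul, Finset.mul_sum, mul_assoc]

lemma row_cs {m r : ℕ} (X W : Matrix (Fin m) (Fin r) ℝ) (i : Fin m) :
    ∑ k, X i k * W i k ≤ rowNorm X i * rowNorm W i :=
  Real.sum_mul_le_sqrt_mul_sqrt _ _ _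

lemma mc_claim_scalar (r Qx Qy x y h q G3 G4 cT eT b : ℝ) (hr0 : 0 < r) (hs1 : 1 ≤ Real.sqrt r)
    (hQx0 : 0 ≤ Qx) (hQy0 : 0 ≤ Qy) (hx0 : 0 ≤ x) (hy0 : 0 < y) (heT : 0 < eT) (hb : 0 < b)
    (hh0 : 0 ≤ h) (hq0 : 0 ≤ q) (hY : b < y) (hX : 0 < cT → b < x)
    (t1 : Qx + cT * x = Qy + eT * y) (t2 : G3 + cT * q = G4 + eT * h ^ 2)
    (g3 : G3 ≤ Qx * h) (g4 : 0 ≤ G4) (g5 : y ≤ Real.sqrt r * h)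
    (hcon : Qx + Qy < eT * y / (4 * Real.sqrt r)) (hXY : q < 3 / 5 * (b * b / r)) : False := by
  have hss : Real.sqrt r * Real.sqrt r = r := Real.mul_self_sqrt (by positivity)
  set s := Real.sqrt r
  set t := eT * y with ht
  have ht0 : 0 < t := by positivity
  have hQ1 : Qx + Qy < t / 4 := by
    refine lt_of_lt_of_le hcon ?_
    rw [div_le_div_iff₀ (by positivity) (by norm_num)]
    nlinarith
  have hcx : 0 < cT * x := by linarith
  have hcT : 0 < cT := by
    by_contra hc'
    push Not at hc'
    nlinarith
  have hbx := hX hcT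
  have hcx2 : cT * x ≤ 5 / 4 * t := by linarith
  have hQ2 : Qx ≤ eT * h / 4 := by
    have h1 : Qx < t / (4 * s) := by linarith
    refine h1.le.trans ?_
    rw [div_le_div_iff₀ (by positivity) (by norm_num)]
    have := mul_le_mul_of_nonneg_left g5 heT.le
    linarith
  have k1 : 3 / 4 * (eT * h ^ 2) ≤ cT * q := by
    have h1 := mul_le_mul_of_nonneg_right hQ2 hh0
    have h2 : eT * h / 4 * h = eT * h ^ 2 / 4 := by ring
    linarith
  have k2 : y ^ 2 ≤ r * h ^ 2 := by
    have : y ^ 2 ≤ (s * h) ^ 2 := pow_le_pow_left₀ hy0.le g5 2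
    rw [mul_pow, pow_two s, hss] at this; exact this
  have k3 : 5 * r * q < 3 * (b * b) := by
    have : 3 / 5 * (b * b / r) = 3 * (b*b) / (5 * r) := by field_simp
    rw [this, lt_div_iff₀ (by positivity)] at hXY
    linarith
  have k4 : b * b ≤ x * y := mul_le_mul hbx.le hY.le hb.le hx0
  have k5 : 5 * r * q < 3 * (x * y) := by linarith
  have k6 : cT * (5 * r * q) < cT * (3 * (x * y)) := mul_lt_mul_of_pos_left k5 hcT
  have k7 : 3 / 4 * (eT * y ^ 2) ≤ r * (cT * q) := by
    have h1 := mul_le_mul_of_nonneg_left k1 hr0.le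
    have h2 := mul_le_mul_of_nonneg_left k2 heT.le
    have h3 : r * (3 / 4 * (eT * h ^ 2)) = 3 / 4 * (eT * (r * h ^ 2)) := by ring
    linarith
  have k8 : cT * x * y ≤ 5 / 4 * t * y := mul_le_mul_of_nonneg_right hcx2 hy0.le
  have h9 : t * y = eT * y ^ 2 := by rw [ht]; ring
  have h10 : cT * (5 * r * q) = 5 * (r * (cT * q)) := by ring
  have h11 : cT * (3 * (x * y)) = 3 * (cT * x * y) := by ring
  have h12 : 5 / 4 * t * y = 5 / 4 * (t * y) := by ring
  linarith

lemma mc_claim {m n r : ℕ} (hr : 1 ≤ r) (X : Matrix (Fin m) (Fin r) ℝ) (Y : Matrix (Fin n) (Fin r) ℝ)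
    (c : Fin m → ℝ) (e : Fin n → ℝ) (cT eT b : ℝ) (hc : ∀ i, 0 ≤ c i) (he : ∀ j, 0 ≤ e j)
    (heT : 0 < eT) (hb : 0 < b)
    (hY : b < frob Y ^ 2) (hX : 0 < cT → b < frob X ^ 2)
    (hS : Xᵀ * (Matrix.diagonal c * X + cT • X) = (Matrix.diagonal e * Y + eT • Y)ᵀ * Y)
    (hXY : frob (X * Yᵀ) ^ 2 < 3 / 5 * (b * b / r)) :
    eT * frob Y ^ 2 / (4 * Real.sqrt r) ≤ ∑ i, c i * rowNorm X i ^ 2 + ∑ j, e j * rowNorm Y j ^ 2 := by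
  by_contra hcon
  push Not at hcon
  have hr1 : (1:ℝ) ≤ r := by exact_mod_cast hr
  have hs1 : 1 ≤ Real.sqrt r := by rw [Real.one_le_sqrt]; exact hr1
  have hr0 : (0:ℝ) < r := by linarith
  set s := Real.sqrt r
  set Qx := ∑ i, c i * rowNorm X i ^ 2 with hQx
  set Qy := ∑ j, e j * rowNorm Y j ^ 2 with hQy
  have hQx0 : 0 ≤ Qx := Finset.sum_nonneg fun i _ => mul_nonneg (hc i) (sq_nonneg _)
  have hQy0 : 0 ≤ Qy := Finset.sum_nonneg fun i _ => mul_nonneg (he i) (sq_nonneg _)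
  set x := frob X ^ 2 with hx
  set y := frob Y ^ 2 with hy
  have hy0 : 0 < y := by linarith
  -- pairing identity
  have pair : ∀ H : Matrix (Fin r) (Fin r) ℝ, Hᵀ = H → finner (Matrix.diagonal c * X) (X * H) + cT * finner X (X * H) =
      finner (Matrix.diagonal e * Y) (Y * H) + eT * finner Y (Y * H) := by
    intro H hH
    have h1 := congrArg (fun W => finner W H) hS
    beta_reduce at h1
    rw [finner_mul_right, Matrix.transpose_transpose, finner_add_left, finner_smul_left] at h1
    rw [h1, ← finner_transpose, Matrix.transpose_mul, Matrix.transpose_transpose, finner_mul_right, Matrix.transpose_transpose, hH, finner_add_left, finner_smul_left]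
  have fX : finner (Matrix.diagonal c * X) X = Qx := by
    rw [finner_diag, hQx]
    refine Finset.sum_congr rfl fun i _ => ?_
    rw [rowNorm_sq]; simp [pow_two]
  have fY : finner (Matrix.diagonal e * Y) Y = Qy := by
    rw [finner_diag, hQy]
    refine Finset.sum_congr rfl fun i _ => ?_
    rw [rowNorm_sq]; simp [pow_two]
  have t1 := pair 1 (by simp)
  rw [Matrix.mul_one, Matrix.mul_one, finner_self, finner_self, fX, fY, ← hx, ← hy] at t1
  set H := Yᵀ * Y with hH
  have t2 := pair H (by rw [hH]; simp)
  have g1 : finner X (X * H) = frob (X * Yᵀ) ^ 2 := by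
    rw [← finner_self, finner_mul_left, Matrix.transpose_transpose, hH, Matrix.mul_assoc]
  have g2 : finner Y (Y * H) = frob H ^ 2 := by
    rw [← finner_self, finner_comm', finner_mul_right]
  have g3 : finner (Matrix.diagonal c * X) (X * H) ≤ Qx * frob H := by
    rw [finner_diag, hQx, Finset.sum_mul]
    refine Finset.sum_le_sum fun i _ => ?_
    rw [mul_assoc]
    apply mul_le_mul_of_nonneg_left _ (hc i)
    have := rowNorm_mul_le X H i
    have h0 := rowNorm_nonneg' X i
    have := row_cs X (X * H) i
    nlinarith
  have g4 : 0 ≤ finner (Matrix.diagonal e * Y) (Y * H) := by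
    rw [finner_diag]
    refine Finset.sum_nonneg fun j _ => mul_nonneg (he j) ?_
    have h1 : ∑ k, Y j k * (Y * H) j k = (Y * Yᵀ * (Y * Yᵀ)ᵀ) j j := by
      have : Y * Yᵀ * (Y * Yᵀ)ᵀ = (Y * H) * Yᵀ := by
        rw [hH]; simp [Matrix.transpose_mul, Matrix.mul_assoc]
      rw [this, Matrix.mul_apply (M := Y * H)]
      simp [mul_comm]
    rw [h1, Matrix.mul_apply]
    refine Finset.sum_nonneg fun k _ => ?_
    rw [Matrix.transpose_apply]
    exact mul_self_nonneg _
  have g5 : y ≤ s * frob H := by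
    have h1 : y = finner (1 : Matrix (Fin r) (Fin r) ℝ) H := by
      rw [hy, ← finner_self, hH, finner_tr, finner_tr]; simp
    have h2 : frob (1 : Matrix (Fin r) (Fin r) ℝ) = s := by
      simp [frob, Matrix.one_apply, s]
    rw [h1, ← h2]; exact finner_le _ _
  rw [g1, g2] at t2
  exact mc_claim_scalar r Qx Qy x y (frob H) (frob (X * Yᵀ) ^ 2) _ _ cT eT b hr0 hs1 hQx0 hQy0 (sq_nonneg _) hy0 heT hb
    (frob_nonneg' _) (sq_nonneg _) hY hX t1 t2 g3 g4 g5 hcon hXY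

lemma mc_reg {m n r : ℕ} (hr : 1 ≤ r) (X U : Matrix (Fin m) (Fin r) ℝ) (Y V : Matrix (Fin n) (Fin r) ℝ)
    (c : Fin m → ℝ) (e : Fin n → ℝ) (cT eT b η : ℝ) (hc : ∀ i, 0 ≤ c i) (he : ∀ j, 0 ≤ e j)
    (hcT : 0 ≤ cT) (heT : 0 ≤ eT) (hb : 0 < b)
    (hY : 0 < eT → b < frob Y ^ 2) (hX : 0 < cT → b < frob X ^ 2)
    (hS : Xᵀ * (Matrix.diagonal c * X + cT • X) = (Matrix.diagonal e * Y + eT • Y)ᵀ * Y)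
    (hXY : frob (X * Yᵀ) ^ 2 < 3 / 5 * (b * b / r))
    (hci : ∀ i, 0 < c i → 4 * rowNorm U i ^ 2 ≤ 3 * rowNorm X i ^ 2)
    (hej : ∀ i, 0 < e i → 4 * rowNorm V i ^ 2 ≤ 3 * rowNorm Y i ^ 2)
    (hXU : 0 ≤ finner X (X - U)) (hYV : -η ≤ finner Y (Y - V)) (hη : η ≤ b / (32 * Real.sqrt r)) :
    0 ≤ finner (Matrix.diagonal c * X + cT • X) (X - U) + finner (Matrix.diagonal e * Y + eT • Y) (Y - V) := by
  have gen : ∀ (k : ℕ) (W Z : Matrix (Fin k) (Fin r) ℝ) (f : Fin k → ℝ), (∀ i, 0 ≤ f i) →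
      (∀ i, 0 < f i → 4 * rowNorm Z i ^ 2 ≤ 3 * rowNorm W i ^ 2) →
      1 / 8 * ∑ i, f i * rowNorm W i ^ 2 ≤ finner (Matrix.diagonal f * W) (W - Z) := by
    intro k W Z f hf h
    rw [finner_diag, Finset.mul_sum]
    refine Finset.sum_le_sum fun i _ => ?_
    rcases (hf i).lt_or_eq with h0 | h0
    · have h1 := h i h0
      have h2 : ∑ l, W i l * (W - Z) i l = rowNorm W i ^ 2 - ∑ l, W i l * Z i l := by
        rw [rowNorm_sq, ← Finset.sum_sub_distrib]
        exact Finset.sum_congr rfl fun l _ => by rw [Matrix.sub_apply]; ring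
      have h3 := row_cs W Z i
      have w0 := rowNorm_nonneg' W i
      have z0 := rowNorm_nonneg' Z i
      have h4 : rowNorm Z i ≤ 7/8 * rowNorm W i := by
        apply sq_le_of_nonneg (by positivity)
        nlinarith [sq_nonneg (rowNorm W i)]
      have h5 : 1/8 * rowNorm W i ^ 2 ≤ ∑ l, W i l * (W - Z) i l := by rw [h2]; nlinarith
      nlinarith
    · rw [← h0]; simp
  have h1 := gen m X U c hc hci
  have h2 := gen n Y V e he hej
  rw [finner_add_left, finner_add_left, finner_smul_left, finner_smul_left]
  have h3 : 0 ≤ cT * finner X (X - U) := mul_nonneg hcT hXU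
  rcases heT.lt_or_eq with h0 | h0
  · have h4 := mc_claim hr X Y c e cT eT b hc he h0 hb (hY h0) hX hS hXY
    have hs0 : 0 < Real.sqrt r := Real.sqrt_pos.2 (by exact_mod_cast hr)
    have h5 : eT * (b / (32 * Real.sqrt r)) ≤ 1/8 * (eT * frob Y ^ 2 / (4 * Real.sqrt r)) := by
      have : 1/8 * (eT * frob Y ^ 2 / (4 * Real.sqrt r)) = eT * (frob Y ^ 2 / (32 * Real.sqrt r)) := by
        field_simp; ring
      rw [this]
      have := hY h0
      gcongr
    have h6 := mul_le_mul_of_nonneg_left hη heT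
    have h7 := mul_le_mul_of_nonneg_left hYV heT
    nlinarith
  · rw [← h0, zero_mul]
    have a1 : 0 ≤ ∑ i, c i * rowNorm X i ^ 2 := Finset.sum_nonneg fun i _ => mul_nonneg (hc i) (sq_nonneg _)
    have a2 : 0 ≤ ∑ i, e i * rowNorm Y i ^ 2 := Finset.sum_nonneg fun i _ => mul_nonneg (he i) (sq_nonneg _)
    linarith

lemma mc_entry_le {m n : ℕ} (A : Matrix (Fin m) (Fin n) ℝ) (i : Fin m) (j : Fin n) : |A i j| ≤ frob A := by
  apply sq_le_of_nonneg (frob_nonneg' _)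
  rw [sq_abs, frob_sq]
  calc A i j ^ 2 ≤ ∑ j, A i j ^ 2 := Finset.single_le_sum (f := fun j => A i j ^ 2) (fun _ _ => sq_nonneg _) (Finset.mem_univ j)
    _ ≤ _ := Finset.single_le_sum (f := fun i => ∑ j, A i j ^ 2) (fun _ _ => Finset.sum_nonneg fun _ _ => sq_nonneg _) (Finset.mem_univ i)

lemma mc_tendsto {m n : ℕ} (Xs : ℕ → Matrix (Fin m) (Fin n) ℝ) (X : Matrix (Fin m) (Fin n) ℝ)
    (h : Filter.Tendsto (fun k => frob (Xs k - X)) Filter.atTop (nhds 0)) :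
    Filter.Tendsto Xs Filter.atTop (nhds X) := by
  refine tendsto_pi_nhds.2 fun i => tendsto_pi_nhds.2 fun j => ?_
  rw [tendsto_iff_dist_tendsto_zero]
  refine squeeze_zero (fun _ => dist_nonneg) (fun k => ?_) h
  rw [Real.dist_eq]
  exact mc_entry_le (Xs k - X) i j

lemma mc_frob_cont {m n : ℕ} : Continuous (frob : Matrix (Fin m) (Fin n) ℝ → ℝ) := by
  unfold frob
  fun_prop

lemma mc_row_cont {m n : ℕ} (i : Fin m) : Continuous (fun A : Matrix (Fin m) (Fin n) ℝ => rowNorm A i) := by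
  unfold rowNorm
  fun_prop

lemma mc_limit {m n r : ℕ} (M : Matrix (Fin m) (Fin n) ℝ) (β1 β2 βT δ : ℝ)
    (Xs : ℕ → Matrix (Fin m) (Fin r) ℝ) (Ys : ℕ → Matrix (Fin n) (Fin r) ℝ)
    (h : ∀ k, K1mem β1 β2 (Xs k) (Ys k) ∧ K2mem βT (Xs k) (Ys k) ∧ Kmem M δ (Xs k) (Ys k))
    (X : Matrix (Fin m) (Fin r) ℝ) (Y : Matrix (Fin n) (Fin r) ℝ)
    (hφ : ∃ φ : ℕ → ℕ, StrictMono φ ∧ Filter.Tendsto (fun k => frob (Xs (φ k) - X)) Filter.atTop (nhds 0) ∧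
      Filter.Tendsto (fun k => frob (Ys (φ k) - Y)) Filter.atTop (nhds 0)) :
    K1mem β1 β2 X Y ∧ K2mem βT X Y ∧ Kmem M δ X Y := by
  obtain ⟨φ, _, h1, h2⟩ := hφ
  have h1 := mc_tendsto (fun k => Xs (φ k)) X h1
  have h2 := mc_tendsto (fun k => Ys (φ k)) Y h2
  refine ⟨⟨fun i => ?_, fun j => ?_⟩, ⟨?_, ?_⟩, ?_⟩
  · exact le_of_tendsto' (((mc_row_cont i).tendsto X).comp h1) fun k => (h (φ k)).1.1 i
  · exact le_of_tendsto' (((mc_row_cont j).tendsto Y).comp h2) fun k => (h (φ k)).1.2 j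
  · exact le_of_tendsto' ((mc_frob_cont.tendsto X).comp h1) fun k => (h (φ k)).2.1.1
  · exact le_of_tendsto' ((mc_frob_cont.tendsto Y).comp h2) fun k => (h (φ k)).2.1.2
  · have hc : Continuous (fun q : Matrix (Fin m) (Fin r) ℝ × Matrix (Fin n) (Fin r) ℝ => frob (M - q.1 * q.2ᵀ)) := by
      refine mc_frob_cont.comp ?_
      exact continuous_const.sub (continuous_fst.matrix_mul continuous_snd.matrix_transpose)
    exact le_of_tendsto' ((hc.tendsto (X, Y)).comp (h1.prodMk_nhds h2)) fun k => (h (φ k)).2.2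

lemma mc_weight (ρ β x : ℝ) (hρ : 0 ≤ ρ) (hβ : 0 < β) :
    0 ≤ ρ * G0' (3 * x / (2 * β ^ 2)) * (3 / β ^ 2) ∧
    (0 < ρ * G0' (3 * x / (2 * β ^ 2)) * (3 / β ^ 2) → 2 / 3 * β ^ 2 < x) := by
  have h0 : 0 ≤ G0' (3 * x / (2 * β ^ 2)) := by unfold G0'; positivity
  refine ⟨by positivity, fun h => ?_⟩
  by_contra hc
  push Not at hc
  have : G0' (3 * x / (2 * β ^ 2)) = 0 := by
    unfold G0'
    rw [max_eq_left]; · simp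
    rw [sub_nonpos, div_le_one (by positivity)]; linarith
  rw [this] at h; simp at h

lemma mc_rowsub {m r : ℕ} (X U : Matrix (Fin m) (Fin r) ℝ) (i : Fin m) :
    rowNorm (X - U) i ^ 2 ≤ 2 * rowNorm X i ^ 2 + 2 * rowNorm U i ^ 2 := by
  rw [rowNorm_sq, rowNorm_sq, rowNorm_sq, Finset.mul_sum, Finset.mul_sum, ← Finset.sum_add_distrib]
  refine Finset.sum_le_sum fun k _ => ?_
  rw [Matrix.sub_apply]
  nlinarith [sq_nonneg (X i k + U i k)]

lemma mc_frobM {m n r : ℕ} (Uh : Matrix (Fin m) (Fin r) ℝ) (Vh : Matrix (Fin n) (Fin r) ℝ)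
    (σ : Fin r → ℝ) (Smax : ℝ) (hU : Uhᵀ * Uh = 1) (hV : Vhᵀ * Vh = 1)
    (h0 : ∀ k, 0 ≤ σ k) (hσ : ∀ k, σ k ≤ Smax) :
    frob (Uh * Matrix.diagonal σ * Vhᵀ) ^ 2 ≤ r * Smax ^ 2 := by
  rw [Matrix.mul_assoc, frob_orth Uh hU, ← frob_transpose, Matrix.transpose_mul, Matrix.transpose_transpose, frob_orth Vh hV,
    Matrix.diagonal_transpose, frob_sq]
  calc ∑ i, ∑ j, Matrix.diagonal σ i j ^ 2 = ∑ i, σ i ^ 2 := by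
        refine Finset.sum_congr rfl fun i _ => ?_
        rw [Finset.sum_eq_single i]
        · simp
        · intro j _ hj; simp [Matrix.diagonal_apply_ne' _ hj]
        · simp
    _ ≤ ∑ i : Fin r, Smax ^ 2 := Finset.sum_le_sum fun i _ => pow_le_pow_left₀ (h0 i) (hσ i) 2
    _ = _ := by simp

lemma mc_cross (p m n μ r κ bT2 c2 d B1 B2 s1 s2 : ℝ) (hp : 0 < p) (hm : 0 < m) (hn : 0 < n) (hμ : 1 ≤ μ) (hr : 1 ≤ r)
    (hs1 : 0 ≤ s1) (hs2 : 0 ≤ s2) (hs1' : s1 ≤ c2 * d ^ 2) (hs2' : s2 ≤ c2 * d ^ 2)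
    (hbT : 0 ≤ bT2) (hB1 : B1 = 4 * (bT2 * (3 * μ * r / m))) (hB2 : B2 = 4 * (bT2 * (3 * μ * r / n)))
    (hbc : bT2 * c2 = 100 * r ^ 2 * κ ^ 2) (hpn : 10 ^ 15 * (μ ^ 2 * r ^ 6 * κ ^ 4) ≤ p * n) :
    10 * Real.sqrt (p * m) * Real.sqrt (B1 * s1) * Real.sqrt (B2 * s2) ≤ p * d ^ 2 / 2500 := by
  have hB10 : 0 ≤ B1 := by rw [hB1]; positivity
  have hB20 : 0 ≤ B2 := by rw [hB2]; positivity
  apply sq_le_of_nonneg (by positivity)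
  rw [mul_pow, mul_pow, mul_pow, Real.sq_sqrt (by positivity), Real.sq_sqrt (by positivity), Real.sq_sqrt (by positivity)]
  have h1 : s1 * s2 ≤ (c2 * d ^ 2) * (c2 * d ^ 2) := mul_le_mul hs1' hs2' hs2 (hs1.trans hs1')
  calc 10 ^ 2 * (p * m) * (B1 * s1) * (B2 * s2) = 100 * (p * m) * (B1 * B2) * (s1 * s2) := by ring
    _ ≤ 100 * (p * m) * (B1 * B2) * ((c2 * d ^ 2) * (c2 * d ^ 2)) := by gcongr
    _ = 14400 * (p / n) * (μ ^ 2 * r ^ 2) * (bT2 * c2) ^ 2 * d ^ 4 := by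
      rw [hB1, hB2]; field_simp; ring
    _ = 144000000 * (p / n) * (μ ^ 2 * r ^ 6 * κ ^ 4) * d ^ 4 := by rw [hbc]; ring
    _ ≤ 144000000 * (p / n) * (p * n / 10 ^ 15) * d ^ 4 := by
      gcongr
      rw [le_div_iff₀ (by norm_num)]; linarith
    _ = 144 / 10 ^ 9 * (p ^ 2 * d ^ 4) := by field_simp; ring
    _ ≤ 1 / 6250000 * (p ^ 2 * d ^ 4) := mul_le_mul_of_nonneg_right (by norm_num) (by positivity)
    _ = _ := by ring

lemma mc_sq2 (a b : ℝ) : (a + b) ^ 2 ≤ 2 * a ^ 2 + 2 * b ^ 2 := by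
  have := sq_nonneg (a - b)
  linarith [this, show (a - b) ^ 2 + (a + b) ^ 2 = 2 * a ^ 2 + 2 * b ^ 2 by ring]

lemma mc_le_mul1 (a b : ℝ) (ha : 1 ≤ a) (hb : 0 ≤ b) : b ≤ a * b := by
  nlinarith

set_option maxHeartbeats 1600000 in
lemma mc_det {m n r : ℕ} (μ : ℝ) (M : Matrix (Fin m) (Fin n) ℝ) (Uh : Matrix (Fin m) (Fin r) ℝ) (Vh : Matrix (Fin n) (Fin r) ℝ)
    (σ : Fin r → ℝ) (Smax Smin κ δ p ρ βT β1 β2 : ℝ) (hm : 1 ≤ m) (hn : 1 ≤ n) (hr : 1 ≤ r) (hμ : 1 ≤ μ)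
    (hU : Uhᵀ * Uh = 1) (hV : Vhᵀ * Vh = 1) (hS : 0 < Smin) (hSS : Smin ≤ Smax)
    (hM : M = Uh * Matrix.diagonal σ * Vhᵀ) (hσ1 : ∀ k, σ k ≤ Smax) (hσ2 : ∀ k, Smin ≤ σ k)
    (hiU : ∀ i, ∑ k, Uh i k ^ 2 ≤ μ * r / m) (hiV : ∀ j, ∑ k, Vh j k ^ 2 ≤ μ * r / n)
    (hκ : κ = Smax / Smin) (hδ : δ * (10 ^ 4 * (r * Real.sqrt r) * κ) = Smin) (hp : 0 < p) (hρ : 0 ≤ ρ)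
    (hβT : βT = Real.sqrt (5 * r * Smax)) (hβ1 : β1 = βT * Real.sqrt (3 * μ * r / m)) (hβ2 : β2 = βT * Real.sqrt (3 * μ * r / n))
    (hpn : 10 ^ 15 * (μ ^ 2 * r ^ 6 * κ ^ 4) ≤ p * n) (Om : Finset (Fin m × Fin n))
    (hE1 : ∀ Z : Matrix (Fin m) (Fin n) ℝ, (1 - Uh * Uhᵀ) * Z * (1 - Vh * Vhᵀ) = 0 →
      p / 16 * ∑ i, ∑ j, Z i j ^ 2 ≤ ∑ e ∈ Om, Z e.1 e.2 ^ 2)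
    (hE2 : ∀ (I : Finset (Fin m)) (J : Finset (Fin n)), ((Om ∩ (I ×ˢ J)).card : ℝ) ≤
      8 * (p * (I.card * J.card)) + 10 * Real.sqrt (p * m * (I.card * J.card)))
    (X : Matrix (Fin m) (Fin r) ℝ) (Y : Matrix (Fin n) (Fin r) ℝ)
    (hK : K1mem β1 β2 X Y ∧ K2mem βT X Y ∧ Kmem M δ X Y)
    (hgX : gradX Om M ρ β1 βT X Y = 0) (hgY : gradY Om M ρ β2 βT X Y = 0) : X * Yᵀ = M := by
  obtain ⟨⟨hK1X, hK1Y⟩, ⟨hK2X, hK2Y⟩, hK⟩ := hK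
  have hm0 : (0:ℝ) < m := by exact_mod_cast (show 0 < m by omega)
  have hn0 : (0:ℝ) < n := by exact_mod_cast (show 0 < n by omega)
  have hr1 : (1:ℝ) ≤ r := by exact_mod_cast hr
  have hr0 : (0:ℝ) < r := by linarith
  have hSm : 0 < Smax := by linarith
  have hκ1 : 1 ≤ κ := by rw [hκ, le_div_iff₀ hS]; linarith
  have hs1 : 1 ≤ Real.sqrt r := by rw [Real.one_le_sqrt]; exact hr1
  have hβT2 : βT ^ 2 = 5 * r * Smax := by rw [hβT, Real.sq_sqrt (by positivity)]
  have hβT0 : 0 < βT := by rw [hβT]; exact Real.sqrt_pos.2 (by positivity)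
  have hβ10 : 0 < β1 := by rw [hβ1]; exact mul_pos hβT0 (Real.sqrt_pos.2 (by positivity))
  have hβ20 : 0 < β2 := by rw [hβ2]; exact mul_pos hβT0 (Real.sqrt_pos.2 (by positivity))
  have hβ12 : β1 ^ 2 = βT ^ 2 * (3 * μ * r / m) := by rw [hβ1, mul_pow, Real.sq_sqrt (by positivity)]
  have hβ22 : β2 ^ 2 = βT ^ 2 * (3 * μ * r / n) := by rw [hβ2, mul_pow, Real.sq_sqrt (by positivity)]
  set sr := Real.sqrt r with hsr
  have hδ0 : 0 < δ := by
    by_contra hc; push Not at hc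
    have : 0 < 10 ^ 4 * (r * sr) * κ := by positivity
    have := mul_nonpos_of_nonpos_of_nonneg hc this.le
    linarith
  have hprod1 : 1 ≤ r * sr * κ := by
    exact one_le_mul_of_one_le_of_one_le (one_le_mul_of_one_le_of_one_le hr1 hs1) hκ1
  have hδs : 10 ^ 4 * δ ≤ Smin := by
    have : δ * 1 ≤ δ * (r * sr * κ) := by gcongr
    have e : δ * (10 ^ 4 * (r * sr) * κ) = 10 ^ 4 * (δ * (r * sr * κ)) := by ring
    rw [e] at hδ
    linarith
  set E := X * Yᵀ - M with hE
  set d := frob E with hd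
  have hd0 : 0 ≤ d := frob_nonneg' _
  have hdδ : d ≤ δ := by
    have h1 : frob (M - X * Yᵀ) ≤ δ := hK
    rw [← frob_neg', neg_sub] at h1; exact h1
  obtain ⟨A, B, hAB, hAβ, hXU, hYV, hXin⟩ := mc_factor Uh Vh σ Smin hU hV hS hσ2 M hM X Y βT hK2X hK2Y (by rw [← hE, ← hd]; linarith)
  rw [← hE, ← hd] at hXU hYV
  set U := Uh * A with hUdef
  set V := Vh * B with hVdef
  set c := 2 * βT / Smin with hc
  have hc0 : 0 < c := by positivity
  have hc2 : c ^ 2 * δ * 10 ^ 4 * sr = 20 := by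
    have : c ^ 2 = 20 * r * Smax / Smin ^ 2 := by rw [hc, div_pow, mul_pow, hβT2]; ring
    rw [this]
    have h2 : δ * 10 ^ 4 * sr * r * Smax = Smin ^ 2 := by
      have : κ * Smin = Smax := by rw [hκ]; field_simp
      rw [← this]
      calc δ * 10 ^ 4 * sr * r * (κ * Smin) = (δ * (10 ^ 4 * (r * sr) * κ)) * Smin := by ring
        _ = _ := by rw [hδ]; ring
    field_simp
    linarith
  have hcδ : c ^ 2 * δ ≤ 1 / 500 := by
    have : 0 < c ^ 2 * δ := by positivity
    have h1 := mc_le_mul1 sr (c ^ 2 * δ) hs1 this.le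
    have e : c ^ 2 * δ * 10 ^ 4 * sr = 10 ^ 4 * (sr * (c ^ 2 * δ)) := by ring
    rw [e] at hc2
    linarith
  have hc2d2 : c ^ 2 * d ^ 2 ≤ d / 500 := by
    have h1 : c ^ 2 * d ≤ c ^ 2 * δ := by gcongr
    calc c ^ 2 * d ^ 2 = c ^ 2 * d * d := by ring
      _ ≤ 1 / 500 * d := mul_le_mul_of_nonneg_right (h1.trans hcδ) hd0
      _ = d / 500 := by ring
  have hcdβ : c * d ≤ βT / 5000 := by
    rw [hc, div_mul_eq_mul_div, div_le_iff₀ hS]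
    calc 2 * βT * d = βT / 5000 * (10 ^ 4 * d) := by ring
      _ ≤ βT / 5000 * Smin := mul_le_mul_of_nonneg_left (by linarith) (by positivity)
  have hBβ : frob B ≤ 11 / 10 * βT := by
    have h1 : frob B = frob V := (frob_orth Vh hV B).symm
    have h2 : V = Y - (Y - V) := by abel
    have h3 := frob_sub_le Y (Y - V)
    rw [← h2] at h3
    linarith
  have hUi : ∀ i, rowNorm U i ^ 2 ≤ μ * r / m * βT ^ 2 := by
    intro i
    have h1 := rowNorm_mul_le Uh A i
    have h2 : rowNorm Uh i ^ 2 ≤ μ * r / m := by rw [rowNorm_sq]; exact hiU i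
    calc rowNorm U i ^ 2 ≤ (rowNorm Uh i * frob A) ^ 2 := pow_le_pow_left₀ (rowNorm_nonneg' _ _) h1 2
      _ = rowNorm Uh i ^ 2 * frob A ^ 2 := by ring
      _ ≤ _ := by gcongr; exact frob_nonneg' _
  have hVj : ∀ j, rowNorm V j ^ 2 ≤ μ * r / n * (11 / 10 * βT) ^ 2 := by
    intro i
    have h1 := rowNorm_mul_le Vh B i
    have h2 : rowNorm Vh i ^ 2 ≤ μ * r / n := by rw [rowNorm_sq]; exact hiV i
    calc rowNorm V i ^ 2 ≤ (rowNorm Vh i * frob B) ^ 2 := pow_le_pow_left₀ (rowNorm_nonneg' _ _) h1 2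
      _ = rowNorm Vh i ^ 2 * frob B ^ 2 := by ring
      _ ≤ _ := by gcongr; exact frob_nonneg' _
  have e1 : μ * r / m * βT ^ 2 = β1 ^ 2 / 3 := by rw [hβ12]; ring
  have e2 : μ * r / n * (11 / 10 * βT) ^ 2 = 121 / 300 * β2 ^ 2 := by rw [hβ22]; ring
  have hs1i : ∀ i, rowNorm (X - U) i ^ 2 ≤ 4 * β1 ^ 2 := by
    intro i
    have h1 := mc_rowsub X U i
    have h2 := hUi i
    have h3 := pow_le_pow_left₀ (rowNorm_nonneg' _ _) (hK1X i) 2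
    have : 0 < β1 ^ 2 := by positivity
    linarith
  have hs2j : ∀ i, rowNorm (Y - V) i ^ 2 ≤ 4 * β2 ^ 2 := by
    intro i
    have h1 := mc_rowsub Y V i
    have h2 := hVj i
    have h3 := pow_le_pow_left₀ (rowNorm_nonneg' _ _) (hK1Y i) 2
    have : 0 < β2 ^ 2 := by positivity
    linarith
  have hfX : frob (X - U) ^ 2 ≤ c ^ 2 * d ^ 2 := by
    rw [← mul_pow]; exact pow_le_pow_left₀ (frob_nonneg' _) hXU 2
  have hfY : frob (Y - V) ^ 2 ≤ c ^ 2 * d ^ 2 := by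
    rw [← mul_pow]; exact pow_le_pow_left₀ (frob_nonneg' _) hYV 2
  have bil := mc_bil2 Om p hp.le hE2 (fun i => rowNorm (X - U) i ^ 2) (fun j => rowNorm (Y - V) j ^ 2) (4 * β1 ^ 2) (4 * β2 ^ 2)
    (fun i => sq_nonneg _) hs1i (fun i => sq_nonneg _) hs2j
  rw [← frob_sq_rows, ← frob_sq_rows] at bil
  have hbc : βT ^ 2 * c ^ 2 = 100 * r ^ 2 * κ ^ 2 := by
    rw [hc, div_pow, mul_pow, hβT2, hκ]; field_simp; ring
  have cross := mc_cross p m n μ r κ (βT ^ 2) (c ^ 2) d (4 * β1 ^ 2) (4 * β2 ^ 2) (frob (X - U) ^ 2) (frob (Y - V) ^ 2)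
    hp hm0 hn0 hμ hr1 (sq_nonneg _) (sq_nonneg _) hfX hfY (sq_nonneg _) (by rw [hβ12]) (by rw [hβ22]) hbc hpn
  have first : 8 * p * frob (X - U) ^ 2 * frob (Y - V) ^ 2 ≤ p * d ^ 2 / 31250 := by
    have h1 : frob (X - U) ^ 2 * frob (Y - V) ^ 2 ≤ (d / 500) * (d / 500) :=
      mul_le_mul (hfX.trans hc2d2) (hfY.trans hc2d2) (sq_nonneg _) (by positivity)
    calc 8 * p * frob (X - U) ^ 2 * frob (Y - V) ^ 2 = 8 * p * (frob (X - U) ^ 2 * frob (Y - V) ^ 2) := by ring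
      _ ≤ 8 * p * ((d / 500) * (d / 500)) := by gcongr
      _ = _ := by ring
  have hbb : ∑ e ∈ Om, rowNorm (X - U) e.1 ^ 2 * rowNorm (Y - V) e.2 ^ 2 ≤ p * d ^ 2 / 2000 := by
    refine bil.trans ?_
    have : 0 ≤ p * d ^ 2 := by positivity
    linarith
  have hprodb : frob (X - U) * frob (Y - V) ≤ d / 2 := by
    have h1 : frob (X - U) * frob (Y - V) ≤ (c * d) * (c * d) := mul_le_mul hXU hYV (frob_nonneg' _) (by positivity)
    have h2 : (c * d) * (c * d) = c ^ 2 * d ^ 2 := by ring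
    linarith
  have main := mc_main Uh Vh hU hV M X U Y V A B rfl rfl hAB Om p (p * d ^ 2 / 2000) hp.le hE1 (by rw [← hE, ← hd]; exact hprodb) hbb
  rw [← hE, ← hd] at main
  -- regularizer
  unfold gradX at hgX
  unfold gradY at hgY
  rw [gradG1_eq, ← hE] at hgX hgY
  set wc : Fin m → ℝ := fun i => ρ * G0' (3 * rowNorm X i ^ 2 / (2 * β1 ^ 2)) * (3 / β1 ^ 2) with hwc
  set we : Fin n → ℝ := fun i => ρ * G0' (3 * rowNorm Y i ^ 2 / (2 * β2 ^ 2)) * (3 / β2 ^ 2) with hwe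
  have wcT := mc_weight ρ βT (frob X ^ 2) hρ hβT0
  have weT := mc_weight ρ βT (frob Y ^ 2) hρ hβT0
  set cT := ρ * G0' (3 * frob X ^ 2 / (2 * βT ^ 2)) * (3 / βT ^ 2) with hcT
  set eT := ρ * G0' (3 * frob Y ^ 2 / (2 * βT ^ 2)) * (3 / βT ^ 2) with heT
  set N := projOmega Om E with hN
  have gX : Matrix.diagonal wc * X + cT • X = -(N * Y) := by
    rw [eq_neg_iff_add_eq_zero, add_comm]; exact hgX
  have gY : Matrix.diagonal we * Y + eT • Y = -(Nᵀ * X) := by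
    rw [eq_neg_iff_add_eq_zero, add_comm]; exact hgY
  have hXYn : frob (X * Yᵀ) ^ 2 < 3 / 5 * ((2 / 3 * βT ^ 2) * (2 / 3 * βT ^ 2) / r) := by
    have h1 : X * Yᵀ = E + M := by rw [hE]; abel
    have h2 := frob_add_le E M
    rw [← h1, ← hd] at h2
    have h3 := mc_frobM Uh Vh σ Smax hU hV (fun k => hS.le.trans (hσ2 k)) hσ1
    rw [← hM] at h3
    have h4 : 3 / 5 * ((2 / 3 * βT ^ 2) * (2 / 3 * βT ^ 2) / r) = 20 / 3 * (r * Smax ^ 2) := by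
      rw [hβT2]; field_simp; norm_num
    rw [h4]
    have h5 : d ^ 2 ≤ r * Smax ^ 2 := by
      have : d ≤ Smax := by linarith
      have : d ^ 2 ≤ Smax ^ 2 := pow_le_pow_left₀ hd0 this 2
      exact this.trans (mc_le_mul1 _ _ hr1 (sq_nonneg Smax))
    have h6 : frob (X * Yᵀ) ^ 2 ≤ (d + frob M) ^ 2 := pow_le_pow_left₀ (frob_nonneg' _) h2 2
    have h7 : 0 < r * Smax ^ 2 := by positivity
    have h8 := mc_sq2 d (frob M)
    linarith
  have hYVin : -(βT * (c * d)) ≤ finner Y (Y - V) := by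
    have h1 := finner_le (-Y) (Y - V)
    have h2 : finner (-Y) (Y - V) = - finner Y (Y - V) := by
      simp [finner]
    rw [frob_neg', h2] at h1
    have h3 : frob Y * frob (Y - V) ≤ βT * (c * d) := mul_le_mul hK2Y hYV (frob_nonneg' _) hβT0.le
    linarith
  have hη : βT * (c * d) ≤ 2 / 3 * βT ^ 2 / (32 * sr) := by
    have h1 : c * δ * 10 ^ 4 * sr ≤ 2 * βT := by
      rw [hc]
      have h2 : δ * 10 ^ 4 * sr ≤ Smin := by
        have : δ * (10 ^ 4 * sr) * 1 ≤ δ * (10 ^ 4 * sr) * (r * κ) := by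
          gcongr; exact one_le_mul_of_one_le_of_one_le hr1 hκ1
        have e : δ * (10 ^ 4 * sr) * (r * κ) = δ * (10 ^ 4 * (r * sr) * κ) := by ring
        rw [e, hδ] at this
        linarith
      calc 2 * βT / Smin * δ * 10 ^ 4 * sr = 2 * βT / Smin * (δ * 10 ^ 4 * sr) := by ring
        _ ≤ 2 * βT / Smin * Smin := by gcongr
        _ = _ := by field_simp
    have h2 : c * d ≤ c * δ := by gcongr
    rw [le_div_iff₀ (by positivity)]
    have h3 : c * d * sr ≤ c * δ * sr := by gcongr
    have h4 : c * d * sr * 32 ≤ 2 / 3 * βT := by linarith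
    calc βT * (c * d) * (32 * sr) = βT * (c * d * sr * 32) := by ring
      _ ≤ βT * (2 / 3 * βT) := by gcongr
      _ = _ := by ring
  have reg := mc_reg hr X U Y V wc we cT eT (2 / 3 * βT ^ 2) (βT * (c * d))
    (fun i => (mc_weight ρ β1 (rowNorm X i ^ 2) hρ hβ10).1) (fun i => (mc_weight ρ β2 (rowNorm Y i ^ 2) hρ hβ20).1)
    wcT.1 weT.1 (by positivity) weT.2 wcT.2
    (by rw [gX, gY]; simp [Matrix.transpose_mul, Matrix.mul_assoc])
    hXYn
    (by
      intro i hi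
      have h1 := (mc_weight ρ β1 (rowNorm X i ^ 2) hρ hβ10).2 hi
      have h2 := hUi i
      have : 0 < β1 ^ 2 := by positivity
      linarith)
    (by
      intro i hi
      have h1 := (mc_weight ρ β2 (rowNorm Y i ^ 2) hρ hβ20).2 hi
      have h2 := hVj i
      have : 0 < β2 ^ 2 := by positivity
      linarith)
    hXin hYVin hη
  rw [gX, gY] at reg
  have neg1 : finner (-(N * Y)) (X - U) = - finner (N * Y) (X - U) := by simp [finner]
  have neg2 : finner (-(Nᵀ * X)) (Y - V) = - finner (Nᵀ * X) (Y - V) := by simp [finner]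
  rw [neg1, neg2] at reg
  have hfin : p * d ^ 2 ≤ 0 := by linarith
  have hd2 : d = 0 := by
    by_contra hne
    have : 0 < d := lt_of_le_of_ne hd0 (Ne.symm hne)
    have : 0 < p * d ^ 2 := by positivity
    linarith
  have := frob_eq_zero E hd2
  rw [hE] at this
  exact sub_eq_zero.1 this

lemma mc_scal (m n r μ κ S p : ℝ) (hn : 2 ≤ n) (hnm : n ≤ m) (hr : 1 ≤ r) (hμ : 1 ≤ μ) (hκ : 1 ≤ κ)
    (H : 10 ^ 16 * (m / n) * n * r * κ ^ 2 * max (μ * Real.log n) (Real.sqrt (m / n) * μ ^ 2 * r ^ 6 * κ ^ 4) ≤ S)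
    (hp : p = S / (m * n)) :
    10 ^ 15 * (μ ^ 2 * r ^ 6 * κ ^ 4) ≤ p * n ∧ 10 ^ 15 * (μ * r) * (1 + Real.log m) ≤ p * n := by
  have hn0 : 0 < n := by linarith
  have hm0 : 0 < m := by linarith
  have hr0 : 0 < r := by linarith
  have hμ0 : 0 < μ := by linarith
  have hκ0 : 0 < κ := by linarith
  have ha : 1 ≤ m / n := by rw [le_div_iff₀ hn0]; linarith
  have hra : 1 ≤ Real.sqrt (m / n) := by rw [Real.one_le_sqrt]; exact ha
  have hlog : Real.log m ≤ Real.log n + 2 * Real.sqrt (m / n) := by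
    have h1 : Real.log (m / n) = Real.log m - Real.log n := Real.log_div hm0.ne' hn0.ne'
    have h2 : Real.log (Real.sqrt (m / n)) = Real.log (m / n) / 2 := Real.log_sqrt (by positivity)
    have h3 := Real.log_le_sub_one_of_pos (show 0 < Real.sqrt (m / n) by linarith)
    linarith
  set s := Real.sqrt (m / n)
  set l := Real.log n
  have hl : 0 ≤ l := Real.log_nonneg (by linarith)
  set W := max (μ * l) (s * μ ^ 2 * r ^ 6 * κ ^ 4) with hW
  have hW1 : μ * l ≤ W := le_max_left _ _
  have hW2 : s * μ ^ 2 * r ^ 6 * κ ^ 4 ≤ W := le_max_right _ _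
  have hW0 : 0 ≤ W := le_trans (by positivity) hW1
  have hpn : p * n = S / m := by rw [hp]; field_simp
  have key : 10 ^ 16 * r * W ≤ p * n := by
    rw [hpn, le_div_iff₀ hm0]
    have e : 10 ^ 16 * (m / n) * n * r * κ ^ 2 * W = κ ^ 2 * (10 ^ 16 * r * W * m) := by field_simp
    rw [e] at H
    exact (mc_le_mul1 _ _ (one_le_pow₀ hκ) (by positivity)).trans H
  have hA : μ ^ 2 * r ^ 6 * κ ^ 4 ≤ W := by
    refine le_trans (mc_le_mul1 s _ hra (by positivity)) ?_
    linarith [hW2, show s * (μ ^ 2 * r ^ 6 * κ ^ 4) = s * μ ^ 2 * r ^ 6 * κ ^ 4 by ring]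
  have hB : s * μ ≤ W := by
    refine le_trans ?_ hW2
    have h1 : 1 ≤ μ * (r ^ 6 * κ ^ 4) := one_le_mul_of_one_le_of_one_le hμ
      (one_le_mul_of_one_le_of_one_le (one_le_pow₀ hr) (one_le_pow₀ hκ))
    have := mc_le_mul1 _ (s * μ) h1 (by positivity)
    linarith [this, show μ * (r ^ 6 * κ ^ 4) * (s * μ) = s * μ ^ 2 * r ^ 6 * κ ^ 4 by ring]
  constructor
  · refine le_trans ?_ key
    have := mc_le_mul1 r W hr hW0
    linarith [show 10 ^ 16 * r * W = 10 ^ 16 * (r * W) by ring]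
  · refine le_trans ?_ key
    have h1 : μ * (1 + Real.log m) ≤ 4 * W := by
      have : μ * (1 + Real.log m) ≤ μ * (l + 3 * s) := mul_le_mul_of_nonneg_left (by linarith) hμ0.le
      linarith [show μ * (l + 3 * s) = μ * l + 3 * (s * μ) by ring]
    calc 10 ^ 15 * (μ * r) * (1 + Real.log m) = 10 ^ 15 * r * (μ * (1 + Real.log m)) := by ring
      _ ≤ 10 ^ 15 * r * (4 * W) := by gcongr
      _ ≤ 10 ^ 16 * r * W := by
        have : 0 ≤ r * W := by positivity
        linarith [show 10 ^ 16 * r * W = 10 ^ 16 * (r * W) by ring, show 10 ^ 15 * r * (4 * W) = 4 * 10 ^ 15 * (r * W) by ring]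

lemma mc_q (m n r μ p : ℝ) (hn : 2 ≤ n) (hnm : n ≤ m) (hr : 1 ≤ r) (hμ : 1 ≤ μ) (hp0 : 0 < p) (hp1 : p ≤ 1)
    (H : 10 ^ 15 * (μ * r) * (1 + Real.log m) ≤ p * n) :
    ∃ q : ℕ, 1 ≤ q ∧ (q : ℝ) * (μ * r / m + μ * r / n) ≤ 1 / 2 ∧ (q : ℝ) ≤ n ∧
      2 * (m * n) * Real.exp (- (q * p / 16)) ≤ 1 / n ^ 4 := by
  have hn0 : 0 < n := by linarith
  have hm0 : 0 < m := by linarith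
  have hx1 : 1 ≤ μ * r := one_le_mul_of_one_le_of_one_le hμ hr
  set x := μ * r
  have hx0 : 0 < x := by linarith
  have hl : 0 ≤ Real.log m := Real.log_nonneg (by linarith)
  set l := Real.log m with hldef
  have hxl : 0 ≤ x * l := by positivity
  have hpn : p * n ≤ n := by nlinarith
  have hy : 1 ≤ n / (4 * x) := by
    rw [le_div_iff₀ (by positivity)]
    linarith [show 10 ^ 15 * x * (1 + l) = 10 ^ 15 * x + 10 ^ 15 * (x * l) by ring]
  set y := n / (4 * x) with hydef
  have hq1 : 1 ≤ ⌊y⌋₊ := Nat.le_floor (by exact_mod_cast hy)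
  have hq2 : (⌊y⌋₊ : ℝ) ≤ y := Nat.floor_le (by linarith)
  have hq3 : y < ⌊y⌋₊ + 1 := Nat.lt_floor_add_one y
  have hq1' : (1:ℝ) ≤ ⌊y⌋₊ := by exact_mod_cast hq1
  refine ⟨⌊y⌋₊, hq1, ?_, ?_, ?_⟩
  · have h1 : x / m ≤ x / n := by gcongr
    calc (⌊y⌋₊ : ℝ) * (x / m + x / n) ≤ y * (x / n + x / n) := by gcongr
      _ = 1 / 2 := by rw [hydef]; field_simp; norm_num
  · refine hq2.trans ?_
    rw [hydef, div_le_iff₀ (by positivity)]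
    nlinarith
  · have h1 : 1 + 6 * l ≤ ⌊y⌋₊ * p / 16 := by
      have h2 : y / 2 * p ≤ ⌊y⌋₊ * p := by gcongr; linarith
      have h3 : 16 * (1 + 6 * l) ≤ y / 2 * p := by
        rw [hydef, div_div, div_mul_eq_mul_div, le_div_iff₀ (by positivity)]
        linarith [show 10 ^ 15 * x * (1 + l) = 10 ^ 15 * x + 10 ^ 15 * (x * l) by ring,
          show 16 * (1 + 6 * l) * (4 * x * 2) = 128 * x + 768 * (x * l) by ring]
      linarith
    have h2 : Real.exp (-(⌊y⌋₊ * p / 16)) ≤ Real.exp (-(1 + 6 * l)) := Real.exp_le_exp.2 (by linarith)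
    have h3 : 2 * m ^ 6 ≤ Real.exp (1 + 6 * l) := by
      rw [Real.exp_add, show (6:ℝ) * l = (6:ℕ) * l by norm_num, Real.exp_nat_mul, hldef, Real.exp_log hm0]
      have := Real.add_one_le_exp 1
      gcongr; linarith
    have h4 : m * n * n ^ 4 ≤ m ^ 6 := by
      calc m * n * n ^ 4 ≤ m * m * m ^ 4 := by gcongr
        _ = _ := by ring
    rw [le_div_iff₀ (by positivity)]
    calc 2 * (m * n) * Real.exp (-(⌊y⌋₊ * p / 16)) * n ^ 4 ≤ 2 * (m * n) * Real.exp (-(1 + 6 * l)) * n ^ 4 := by gcongr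
      _ = 2 * (m * n * n ^ 4) / Real.exp (1 + 6 * l) := by rw [Real.exp_neg]; field_simp
      _ ≤ 1 := by rw [div_le_one (Real.exp_pos _)]; linarith

lemma mc_union {α : Type*} (s : Finset α) (g b1 b2 : α → Prop) [DecidablePred g] [DecidablePred b1] [DecidablePred b2] (t : ℝ)
    (h : ∀ a ∈ s, ¬ b1 a → ¬ b2 a → g a) (h1 : ((s.filter b1).card : ℝ) ≤ t) (h2 : ((s.filter b2).card : ℝ) ≤ t) :
    (s.card : ℝ) - 2 * t ≤ ((s.filter g).card : ℝ) := by
  have hsub : s ⊆ s.filter g ∪ (s.filter b1 ∪ s.filter b2) := by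
    intro a ha
    by_cases c1 : b1 a
    · simp [ha, c1]
    by_cases c2 : b2 a
    · simp [ha, c2]
    simp [ha, h a ha c1 c2]
  have hc := (Finset.card_le_card hsub).trans ((Finset.card_union_le _ _).trans (Nat.add_le_add_left (Finset.card_union_le _ _) _))
  have : (s.card : ℝ) ≤ (s.filter g).card + ((s.filter b1).card + (s.filter b2).card) := by exact_mod_cast hc
  linarith

lemma mc_32 (r : ℝ) (hr : 1 ≤ r) : r ^ ((3 : ℝ) / 2) = r * Real.sqrt r := by
  rw [show (3:ℝ)/2 = 1 + 1/2 by norm_num, Real.rpow_add (by linarith), Real.rpow_one, Real.sqrt_eq_rpow]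

lemma mc_core (m n r : ℕ) (μ : ℝ) (M : Matrix (Fin m) (Fin n) ℝ)
    (Uh : Matrix (Fin m) (Fin r) ℝ) (Vh : Matrix (Fin n) (Fin r) ℝ)
    (σ : Fin r → ℝ) (Smax Smin : ℝ) (hn : 1 ≤ n) (hnm : n ≤ m) (hr : 1 ≤ r) (hμ : 1 ≤ μ)
    (hU : Uhᵀ * Uh = 1) (hV : Vhᵀ * Vh = 1) (hσ : ∀ k, 0 < σ k)
    (hM : M = Uh * Matrix.diagonal σ * Vhᵀ) (hmax : (∀ k, σ k ≤ Smax) ∧ ∃ k, σ k = Smax)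
    (hmin : (∀ k, Smin ≤ σ k) ∧ ∃ k, σ k = Smin)
    (hiU : ∀ i, ∑ k, Uh i k ^ 2 ≤ μ * r / m) (hiV : ∀ j, ∑ k, Vh j k ^ 2 ≤ μ * r / n) (S : ℕ)
    (κ δ p ρ βT β1 β2 : ℝ)
    (H : 10 ^ 16 * ((m : ℝ) / n) * n * r * κ ^ 2 * max (μ * Real.log n)
                (Real.sqrt ((m : ℝ) / n) * μ ^ 2 * (r : ℝ) ^ 6 * κ ^ 4) ≤ S)
    (hκ : κ = Smax / Smin) (hδ' : δ = Smin / (10 ^ 4 * (r : ℝ) ^ ((3 : ℝ) / 2) * κ))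
    (hp : p = (S : ℝ) / (m * n)) (hρ' : ρ = 8 * p * (δ / 6) ^ 2) (hβT : βT = Real.sqrt (5 * r * Smax))
    (hβ1 : β1 = βT * Real.sqrt (3 * μ * r / m)) (hβ2 : β2 = βT * Real.sqrt (3 * μ * r / n)) :
          (1 - 2 / (n : ℝ) ^ 4) *
              ((Finset.powersetCard S (Finset.univ : Finset (Fin m × Fin n))).card : ℝ) ≤
            (((Finset.powersetCard S (Finset.univ : Finset (Fin m × Fin n))).filter
                (fun Ω =>
                  ∀ (Xs : ℕ → Matrix (Fin m) (Fin r) ℝ) (Ys : ℕ → Matrix (Fin n) (Fin r) ℝ),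
                    (∀ k, K1mem β1 β2 (Xs k) (Ys k) ∧ K2mem βT (Xs k) (Ys k) ∧
                      Kmem M δ (Xs k) (Ys k)) →
                    ∀ (Xstar : Matrix (Fin m) (Fin r) ℝ) (Ystar : Matrix (Fin n) (Fin r) ℝ),
                      (∃ φ : ℕ → ℕ, StrictMono φ ∧
                          Filter.Tendsto (fun k => frob (Xs (φ k) - Xstar))
                            Filter.atTop (nhds 0) ∧
                          Filter.Tendsto (fun k => frob (Ys (φ k) - Ystar))
                            Filter.atTop (nhds 0)) →
                      gradX Ω M ρ β1 βT Xstar Ystar = 0 →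
                      gradY Ω M ρ β2 βT Xstar Ystar = 0 →
                      Xstar * Ystarᵀ = M)).card : ℝ) := by
  obtain ⟨hσ1, k1, hk1⟩ := hmax
  obtain ⟨hσ2, k2, hk2⟩ := hmin
  have hS : 0 < Smin := hk2 ▸ hσ k2
  have hSS : Smin ≤ Smax := hk1 ▸ hσ2 k1
  have hκ1 : 1 ≤ κ := by
    rw [hκ, le_div_iff₀ hS]; linarith
  have hcard : (Finset.powersetCard S (Finset.univ : Finset (Fin m × Fin n))).card = (m * n).choose S := by
    rw [Finset.card_powersetCard]; simp
  by_cases hSmn : S ≤ m * n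
  swap
  · rw [hcard, Nat.choose_eq_zero_of_lt (by omega)]
    simp
  by_cases hn1 : n = 1
  · refine le_trans ?_ (Nat.cast_nonneg _)
    apply mul_nonpos_of_nonpos_of_nonneg _ (Nat.cast_nonneg _)
    rw [hn1]; norm_num
  have hn2 : (2:ℝ) ≤ n := by exact_mod_cast (show 2 ≤ n by omega)
  have hnm' : (n:ℝ) ≤ m := by exact_mod_cast hnm
  have hr1 : (1:ℝ) ≤ r := by exact_mod_cast hr
  have hn0 : (0:ℝ) < n := by linarith
  have hm0 : (0:ℝ) < m := by linarith
  obtain ⟨hA, hB⟩ := mc_scal m n r μ κ S p hn2 hnm' hr1 hμ hκ1 H hp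
  have hlm : 0 ≤ Real.log m := Real.log_nonneg (by linarith)
  have hμr : 1 ≤ μ * r := one_le_mul_of_one_le_of_one_le hμ hr1
  have hpn : 1 + Real.log m ≤ p * n := by
    refine le_trans (mc_le_mul1 (10 ^ 15 * (μ * r)) _ (by linarith) (by linarith)) hB
  have hp0 : 0 < p := by
    by_contra hc
    have := mul_nonpos_of_nonpos_of_nonneg (not_lt.1 hc) hn0.le
    linarith
  have hS0 : 0 < S := by
    rcases Nat.eq_zero_or_pos S with h | h
    · exfalso
      have : p = 0 := by rw [hp, h]; simp
      linarith
    · exact h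
  have hp1 : p ≤ 1 := by
    rw [hp, div_le_one (by positivity)]
    exact_mod_cast hSmn
  obtain ⟨q, hq1, hq2, hq3, hq4⟩ := mc_q m n r μ p hn2 hnm' hr1 hμ hp0 hp1 hB
  have hqn : q ≤ n := by exact_mod_cast hq3
  have e1 := mc_E1 μ Uh Vh hU hV hiU hiV q hq1 hq2 (hqn.trans (Nat.le_mul_of_pos_left n (by omega))) S hSmn p hp
  have e2 := mc_E2 m n S hn hnm hSmn hS0 p hp hpn
  have e1' := e1.trans (mul_le_mul_of_nonneg_right hq4 (Nat.cast_nonneg _))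
  rw [one_div_mul_eq_div] at e1'
  have hδ : δ * (10 ^ 4 * (r * Real.sqrt r) * κ) = Smin := by
    rw [hδ', mc_32 _ hr1]
    have : 0 < Real.sqrt r := Real.sqrt_pos.2 (by linarith)
    have : 0 < κ := by linarith
    have : (0:ℝ) < r := by linarith
    field_simp
  have hρ : 0 ≤ ρ := by
    rw [hρ']
    positivity
  refine le_trans (le_of_eq ?_) (mc_union _ _ _ _ _ (fun Om _ hb1 hb2 => ?_) e1' e2)
  · rw [hcard]; ring
  · push Not at hb1 hb2
    intro Xs Ys hXY X Y hφ hgX hgY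
    have hK := mc_limit M β1 β2 βT δ Xs Ys hXY X Y hφ
    exact mc_det μ M Uh Vh σ Smax Smin κ δ p ρ βT β1 β2 (by omega) hn hr hμ hU hV hS hSS hM hσ1 hσ2 hiU hiV
      hκ hδ hp0 hρ hβT hβ1 hβ2 hA Om hb1 hb2 X Y hK hgX hgY

/-- With probability at least `1 - 2/n⁴` (uniform sampling model, encoded
by counting subsets of size `S`): for every sequence `((X_k, Y_k))_k` staying in
`K₁ ∩ K₂ ∩ K(δ)`, every limit point (in the Frobenius-norm topology, i.e. along a
subsequence) which is a stationary point of `F̃` satisfies `X*·(Y*)ᵀ = M`. -/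
theorem stmt2 :
    ∃ C0 Cd CT : ℝ, 0 < C0 ∧ 0 < Cd ∧ 0 < CT ∧
      ∀ (m n r : ℕ) (μ : ℝ) (M : Matrix (Fin m) (Fin n) ℝ)
        (Uh : Matrix (Fin m) (Fin r) ℝ) (Vh : Matrix (Fin n) (Fin r) ℝ)
        (σ : Fin r → ℝ) (Smax Smin : ℝ),
        1 ≤ n → n ≤ m → 1 ≤ r → 1 ≤ μ →
        Uhᵀ * Uh = 1 → Vhᵀ * Vh = 1 →
        (∀ k, 0 < σ k) → (∀ k l : Fin r, k ≤ l → σ l ≤ σ k) →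
        M = Uh * Matrix.diagonal σ * Vhᵀ →
        ((∀ k, σ k ≤ Smax) ∧ ∃ k, σ k = Smax) →
        ((∀ k, Smin ≤ σ k) ∧ ∃ k, σ k = Smin) →
        (∀ i, ∑ k, Uh i k ^ 2 ≤ μ * r / m) →
        (∀ j, ∑ k, Vh j k ^ 2 ≤ μ * r / n) →
        ∀ S : ℕ,
          C0 * ((m : ℝ) / n) * n * r * (Smax / Smin) ^ 2 *
              max (μ * Real.log n)
                (Real.sqrt ((m : ℝ) / n) * μ ^ 2 * (r : ℝ) ^ 6 * (Smax / Smin) ^ 4) ≤ S →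
          let κ : ℝ := Smax / Smin
          let δ : ℝ := Smin / (Cd * (r : ℝ) ^ ((3 : ℝ) / 2) * κ)
          let δ0 : ℝ := δ / 6
          let p : ℝ := (S : ℝ) / (m * n)
          let ρ : ℝ := 8 * p * δ0 ^ 2
          let βT : ℝ := Real.sqrt (CT * r * Smax)
          let β1 : ℝ := βT * Real.sqrt (3 * μ * r / m)
          let β2 : ℝ := βT * Real.sqrt (3 * μ * r / n)
          (1 - 2 / (n : ℝ) ^ 4) *
              ((Finset.powersetCard S (Finset.univ : Finset (Fin m × Fin n))).card : ℝ) ≤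
            (((Finset.powersetCard S (Finset.univ : Finset (Fin m × Fin n))).filter
                (fun Ω =>
                  ∀ (Xs : ℕ → Matrix (Fin m) (Fin r) ℝ) (Ys : ℕ → Matrix (Fin n) (Fin r) ℝ),
                    (∀ k, K1mem β1 β2 (Xs k) (Ys k) ∧ K2mem βT (Xs k) (Ys k) ∧
                      Kmem M δ (Xs k) (Ys k)) →
                    ∀ (Xstar : Matrix (Fin m) (Fin r) ℝ) (Ystar : Matrix (Fin n) (Fin r) ℝ),
                      (∃ φ : ℕ → ℕ, StrictMono φ ∧
                          Filter.Tendsto (fun k => frob (Xs (φ k) - Xstar))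
                            Filter.atTop (nhds 0) ∧
                          Filter.Tendsto (fun k => frob (Ys (φ k) - Ystar))
                            Filter.atTop (nhds 0)) →
                      gradX Ω M ρ β1 βT Xstar Ystar = 0 →
                      gradY Ω M ρ β2 βT Xstar Ystar = 0 →
                      Xstar * Ystarᵀ = M)).card : ℝ) := by
  refine ⟨10 ^ 16, 10 ^ 4, 5, by norm_num, by norm_num, by norm_num, ?_⟩
  intro m n r μ M Uh Vh σ Smax Smin hn hnm hr hμ hU hV hσ _ hM hmax hmin hiU hiV S H
  intro κ δ δ0 p ρ βT β1 β2
  exact mc_core m n r μ M Uh Vh σ Smax Smin hn hnm hr hμ hU hV hσ hM hmax hmin hiU hiV S κ δ p ρ βT β1 β2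
    H rfl rfl rfl rfl rfl rfl rfl

end
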